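/- arXiv:1210.1542 — 9 statements merged into one kernel-verified Lean document; each statement's English description precedes it below -/
import Mathlib

section
/- For every σ ∈ (0, 1/2] there exists a constant C > 0 such that for every measurable function f : ℤ × ℝ → [0, ∞), one has Σ_{n∈ℤ} ∫_ℝ ( Σ_{(n₁,n₂)∈ℤ²} ∫_{ℝ²} f(n₁, ξ₁) · f(n₂, ξ₂) · f(n − n₁ − n₂, ξ − ξ₁ − ξ₂) dξ₁ dξ₂ )² dξ ≤ C · ( Σ_{n∈ℤ} ∫_ℝ ⟨n⟩^{2σ} · ⟨ξ + n²⟩^{1+2σ} · f(n, ξ)² dξ )³. -/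
open MeasureTheory
open scoped ENNReal

/-- The Japanese bracket `⟨x⟩ = (1 + x²)^(1/2)`. -/
noncomputable def jb (x : ℝ) : ℝ := Real.sqrt (1 + x ^ 2)

/-- Every divisor of `y` lies in some finite set with at most `B` elements. -/
def DivisorCountLE {R : Type*} [CommRing R] (y : R) (B : ℕ) : Prop :=
  ∃ s : Finset R, (∀ x, x ∣ y → x ∈ s) ∧ s.card ≤ B

namespace DivisorCountLE

variable {R : Type*} [CommRing R]

theorem mul [IsDomain R] [IsPrincipalIdealRing R] {y z : R} {A B : ℕ}
    (hy : DivisorCountLE y A) (hz : DivisorCountLE z B) : DivisorCountLE (y * z) (A * B) := by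
  classical
  obtain ⟨s, hs, hsA⟩ := hy
  obtain ⟨t, ht, htB⟩ := hz
  refine ⟨Finset.image₂ (· * ·) s t, fun x hx ↦ ?_,
    (Finset.card_image₂_le _ _ _).trans (Nat.mul_le_mul hsA htB)⟩
  obtain ⟨a, b, ha, hb, rfl⟩ := exists_dvd_and_dvd_of_dvd_mul hx
  exact Finset.mem_image₂.2 ⟨a, hs a ha, b, ht b hb, rfl⟩

theorem one [Finite Rˣ] : DivisorCountLE (1 : R) (Nat.card Rˣ) := by
  classical
  have := Fintype.ofFinite Rˣ
  refine ⟨Finset.univ.image fun u : Rˣ ↦ (u : R), fun x hx ↦ ?_, ?_⟩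
  · obtain ⟨u, rfl⟩ := isUnit_of_dvd_one hx
    simp
  · rw [Nat.card_eq_fintype_card]
    exact Finset.card_image_le

theorem prime_pow [IsDomain R] [Finite Rˣ] {p : R} (hp : Prime p) (n : ℕ) :
    DivisorCountLE (p ^ n) (Nat.card Rˣ * (n + 1)) := by
  classical
  have := Fintype.ofFinite Rˣ
  refine ⟨(Finset.univ ×ˢ Finset.range (n + 1)).image fun q : Rˣ × ℕ ↦ p ^ q.2 * (q.1 : R),
    fun x hx ↦ ?_, ?_⟩
  · obtain ⟨i, hi, hxi⟩ := (dvd_prime_pow hp n).1 hx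
    obtain ⟨u, hu⟩ := hxi.symm
    exact Finset.mem_image.2 ⟨(u, i), by simpa using Nat.lt_succ_of_le hi, hu⟩
  · refine Finset.card_image_le.trans ?_
    rw [Finset.card_product, Finset.card_range, Nat.card_eq_fintype_card, Finset.card_univ]

theorem prod [IsDomain R] [IsPrincipalIdealRing R] [Finite Rˣ] {ι : Type*} (s : Finset ι)
    (y : ι → R) (B : ι → ℕ) (h : ∀ i ∈ s, DivisorCountLE (y i) (B i)) :
    DivisorCountLE (∏ i ∈ s, y i) (Nat.card Rˣ * ∏ i ∈ s, B i) := by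
  classical
  induction s using Finset.induction_on with
  | empty => simpa using one
  | insert a s ha ih =>
    rw [Finset.prod_insert ha, Finset.prod_insert ha, mul_left_comm]
    exact (h a (Finset.mem_insert_self a s)).mul
      (ih fun i hi ↦ h i (Finset.mem_insert_of_mem hi))

end DivisorCountLE

section Eisenstein

open NumberField

theorem natAbs_norm_eq_one_iff {K : Type*} [Field K] [NumberField K] {x : 𝓞 K} :
    (Algebra.norm ℤ x).natAbs = 1 ↔ IsUnit x := by
  rw [NumberField.isUnit_iff_norm, RingOfIntegers.coe_norm, ← Algebra.coe_norm_int,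
    ← Int.cast_abs, ← Int.natCast_natAbs]
  norm_cast

theorem irreducible_of_prime_natAbs_norm {K : Type*} [Field K] [NumberField K] {x : 𝓞 K}
    (hx : (Algebra.norm ℤ x).natAbs.Prime) : Irreducible x := by
  refine ⟨fun h ↦ hx.ne_one (natAbs_norm_eq_one_iff.2 h), fun a b hab ↦ ?_⟩
  rw [hab, map_mul, Int.natAbs_mul, Nat.prime_mul_iff] at hx
  rcases hx with h | h
  · exact Or.inr (natAbs_norm_eq_one_iff.1 h.2)
  · exact Or.inl (natAbs_norm_eq_one_iff.1 h.2)

theorem divisorCountLE_natCast_prime_pow {K : Type*} [Field K] [NumberField K]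
    [IsPrincipalIdealRing (𝓞 K)] [Finite (𝓞 K)ˣ] (hK : Module.finrank ℚ K = 2)
    {p : ℕ} (hp : p.Prime) (n : ℕ) :
    DivisorCountLE ((p : 𝓞 K) ^ n) ((Nat.card (𝓞 K)ˣ * (n + 1)) ^ 2) := by
  have hnorm : (Algebra.norm ℤ (p : 𝓞 K)).natAbs = p ^ 2 := by
    rw [← map_natCast (algebraMap ℤ (𝓞 K)), Algebra.norm_algebraMap_of_basis
      (Module.Free.chooseBasis ℤ (𝓞 K)), ← Module.finrank_eq_card_chooseBasisIndex,
      RingOfIntegers.rank, hK]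
    simp [Int.natAbs_pow]
  by_cases hirr : Irreducible (p : 𝓞 K)
  · obtain ⟨s, hs, hc⟩ := DivisorCountLE.prime_pow hirr.prime n
    exact ⟨s, hs, hc.trans (Nat.le_self_pow two_ne_zero _)⟩
  · have hu : ¬ IsUnit (p : 𝓞 K) := fun h ↦ by
      rw [← natAbs_norm_eq_one_iff, hnorm] at h
      exact hp.one_lt.ne' (by simpa using h)
    obtain ⟨x, y, hxy, hx, hy⟩ : ∃ x y : 𝓞 K, (p : 𝓞 K) = x * y ∧ ¬ IsUnit x ∧ ¬ IsUnit y := by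
      by_contra! h
      exact hirr ⟨hu, fun a b hab ↦ or_iff_not_imp_left.2 (h a b hab)⟩
    rw [← natAbs_norm_eq_one_iff] at hx hy
    rw [hxy, map_mul, Int.natAbs_mul] at hnorm
    obtain ⟨h1, h2⟩ := (Nat.Prime.mul_eq_prime_sq_iff hp hx hy).1 hnorm
    rw [hxy, mul_pow, sq]
    exact (DivisorCountLE.prime_pow (irreducible_of_prime_natAbs_norm (h1 ▸ hp)).prime n).mul
      (DivisorCountLE.prime_pow (irreducible_of_prime_natAbs_norm (h2 ▸ hp)).prime n)

theorem divisorCountLE_natCast {K : Type*} [Field K] [NumberField K]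
    [IsPrincipalIdealRing (𝓞 K)] [Finite (𝓞 K)ˣ] (hK : Module.finrank ℚ K = 2)
    {M : ℕ} (hM : M ≠ 0) :
    DivisorCountLE (M : 𝓞 K) (Nat.card (𝓞 K)ˣ *
      ∏ p ∈ M.primeFactors, (Nat.card (𝓞 K)ˣ * (M.factorization p + 1)) ^ 2) := by
  have h := DivisorCountLE.prod M.primeFactors (fun p ↦ (p : 𝓞 K) ^ M.factorization p) _
    fun p hp ↦ divisorCountLE_natCast_prime_pow hK (Nat.prime_of_mem_primeFactors hp)
      (M.factorization p)
  have hprod : ∏ p ∈ M.primeFactors, (p : 𝓞 K) ^ M.factorization p = M := by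
    conv_rhs => rw [← Nat.prod_factorization_pow_eq_self hM]
    simp [Finsupp.prod]
  rwa [hprod] at h

/-- The number of representations of `M` by `a² + ab + b²`, in terms of its factorization. -/
theorem exists_card_le_of_sq_add_mul_add_sq_eq : ∃ U : ℕ, 0 < U ∧ ∀ M : ℕ, M ≠ 0 →
    ∀ s : Finset (ℤ × ℤ), (∀ q ∈ s, q.1 ^ 2 + q.1 * q.2 + q.2 ^ 2 = M) →
      s.card ≤ U * ∏ p ∈ M.primeFactors, (U * (M.factorization p + 1)) ^ 2 := by
  let K := CyclotomicField 3 ℚ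
  have : IsCyclotomicExtension {3} ℚ K := CyclotomicField.isCyclotomicExtension 3 ℚ
  have : IsPrincipalIdealRing (𝓞 K) := IsCyclotomicExtension.Rat.three_pid K
  have hζ : IsPrimitiveRoot (IsCyclotomicExtension.zeta 3 ℚ K) 3 :=
    IsCyclotomicExtension.zeta_spec 3 ℚ K
  have : Finite (𝓞 K)ˣ := by
    refine Set.finite_univ_iff.1 ((List.finite_toSet _).subset fun u _ ↦
      IsCyclotomicExtension.Rat.Three.Units.mem hζ u)
  have hK : Module.finrank ℚ K = 2 := by
    rw [IsCyclotomicExtension.finrank (n := 3) K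
      (Polynomial.cyclotomic.irreducible_rat (by simp))]
    rfl
  refine ⟨Nat.card (𝓞 K)ˣ, Nat.card_pos, fun M hM s hs ↦ ?_⟩
  obtain ⟨t, ht, htc⟩ := divisorCountLE_natCast (K := K) hK hM
  refine le_trans ?_ htc
  set z : 𝓞 K := hζ.toInteger
  have hz : z ^ 2 + z + 1 = 0 := IsCyclotomicExtension.Rat.Three.eta_sq_add_eta_add_one hζ
  have hform : ∀ a b : ℤ, ((a : 𝓞 K) - b * z) * (a + b + b * z) =
      ((a ^ 2 + a * b + b ^ 2 : ℤ) : 𝓞 K) := fun a b ↦ by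
    push_cast
    linear_combination (-(b : 𝓞 K) ^ 2) * hz
  refine Finset.card_le_card_of_injOn (fun q ↦ (q.1 : 𝓞 K) - q.2 * z) (fun q hq ↦ ?_) ?_
  · refine ht _ (Dvd.intro (q.1 + q.2 + q.2 * z : 𝓞 K) ?_)
    rw [hform, hs q hq]
    simp
  · rintro ⟨a, b⟩ - ⟨c, d⟩ - h
    have h' : ((a - c : ℤ) : 𝓞 K) - ((b - d : ℤ) : 𝓞 K) * z = 0 := by
      push_cast
      linear_combination h
    have h0 := hform (a - c) (b - d)
    rw [h', zero_mul] at h0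
    have h1 : (a - c) ^ 2 + (a - c) * (b - d) + (b - d) ^ 2 = 0 := by exact_mod_cast h0.symm
    have hb : b - d = 0 := by
      have := sq_nonneg (2 * (a - c) + (b - d))
      have : (b - d) ^ 2 = 0 := le_antisymm (by nlinarith) (sq_nonneg _)
      simpa using this
    have ha : a - c = 0 := by
      rw [hb] at h1
      simpa using h1
    ext <;> simp <;> omega

end Eisenstein

section DivisorBound

theorem exists_mul_add_one_sq_le_mul_pow (U : ℝ) {r : ℝ} (hr : 1 < r) :
    ∃ A : ℝ, 1 ≤ A ∧ ∀ v : ℕ, (U * (v + 1)) ^ 2 ≤ A * r ^ v := by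
  obtain ⟨B, hB⟩ := (tendsto_pow_const_div_const_pow_of_one_lt 2 hr).bddAbove_range
  have hr0 : 0 < r := zero_lt_one.trans hr
  refine ⟨max 1 (U ^ 2 * B * r), le_max_left _ _, fun v ↦ ?_⟩
  have h : ((v + 1 : ℕ) : ℝ) ^ 2 / r ^ (v + 1) ≤ B := hB ⟨v + 1, rfl⟩
  rw [div_le_iff₀ (by positivity)] at h
  push_cast at h
  calc (U * (v + 1)) ^ 2 = U ^ 2 * ((v : ℝ) + 1) ^ 2 := by ring
    _ ≤ U ^ 2 * (B * r ^ (v + 1)) := by gcongr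
    _ = U ^ 2 * B * r * r ^ v := by ring
    _ ≤ _ := by gcongr; exact le_max_right _ _

theorem exists_prod_primeFactors_le_rpow (U : ℕ) (hU : 0 < U) {ε : ℝ} (hε : 0 < ε) :
    ∃ C : ℝ, 0 < C ∧ ∀ M : ℕ, M ≠ 0 →
      ∏ p ∈ M.primeFactors, ((U : ℝ) * (M.factorization p + 1)) ^ 2 ≤ C * (M : ℝ) ^ ε := by
  obtain ⟨A, hA1, hA⟩ := exists_mul_add_one_sq_le_mul_pow U
    (Real.one_lt_rpow one_lt_two hε)
  set L : ℝ := (2 * U) ^ 2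
  have hL : 0 < L := by positivity
  set P : ℕ := ⌈L ^ (1 / ε)⌉₊
  have hP : ∀ p : ℕ, P ≤ p → L ≤ (p : ℝ) ^ ε := fun p hp ↦ by
    have h : L ^ (1 / ε) ≤ p := (Nat.le_ceil _).trans (by exact_mod_cast hp)
    calc L = (L ^ (1 / ε)) ^ ε := by
          rw [← Real.rpow_mul hL.le, one_div_mul_cancel hε.ne', Real.rpow_one]
      _ ≤ _ := by gcongr
  have hfactor : ∀ p v : ℕ, 2 ≤ p → v ≠ 0 →
      ((U : ℝ) * (v + 1)) ^ 2 ≤ (if p < P then A else 1) * ((p : ℝ) ^ ε) ^ v := fun p v hp hv ↦ by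
    split_ifs with h
    · refine (hA v).trans ?_
      have : (2 : ℝ) ≤ p := by exact_mod_cast hp
      gcongr
    · have h1 : U * (v + 1) ≤ (2 * U) ^ v := by
        rw [mul_pow, mul_comm]
        exact Nat.mul_le_mul Nat.lt_two_pow_self (Nat.le_self_pow hv U)
      have h2 : (U : ℝ) * (v + 1) ≤ (2 * U) ^ v := by exact_mod_cast h1
      calc ((U : ℝ) * (v + 1)) ^ 2 ≤ ((2 * U) ^ v) ^ 2 := by gcongr
        _ = L ^ v := pow_right_comm _ _ _
        _ ≤ 1 * ((p : ℝ) ^ ε) ^ v := by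
          rw [one_mul]
          exact pow_le_pow_left₀ hL.le (hP p (not_lt.1 h)) v
  refine ⟨A ^ P, by positivity, fun M hM ↦ ?_⟩
  have hMε : ∏ p ∈ M.primeFactors, ((p : ℝ) ^ ε) ^ M.factorization p = (M : ℝ) ^ ε := by
    conv_rhs => rw [← Nat.prod_factorization_pow_eq_self hM]
    rw [Finsupp.prod, Nat.support_factorization, Nat.cast_prod,
      ← Real.finsetProd_rpow _ _ fun _ _ ↦ by positivity]
    refine Finset.prod_congr rfl fun p _ ↦ ?_
    rw [Nat.cast_pow, Real.rpow_pow_comm (by positivity)]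
  calc ∏ p ∈ M.primeFactors, ((U : ℝ) * (M.factorization p + 1)) ^ 2
      ≤ ∏ p ∈ M.primeFactors, (if p < P then A else 1) * ((p : ℝ) ^ ε) ^ M.factorization p := by
        refine Finset.prod_le_prod (fun _ _ ↦ by positivity) fun p hp ↦ hfactor p _
          (Nat.prime_of_mem_primeFactors hp).two_le ?_
        rw [← Finsupp.mem_support_iff, Nat.support_factorization]
        exact hp
    _ = A ^ (M.primeFactors.filter (· < P)).card * (M : ℝ) ^ ε := by
        rw [Finset.prod_mul_distrib, hMε, ← Finset.prod_filter, Finset.prod_const]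
    _ ≤ A ^ P * (M : ℝ) ^ ε := by
        gcongr
        refine (Finset.card_le_card fun p hp ↦ ?_).trans (Finset.card_range P).le
        exact Finset.mem_range.2 (Finset.mem_filter.1 hp).2

theorem exists_card_le_rpow_of_sq_add_mul_add_sq_eq {ε : ℝ} (hε : 0 < ε) :
    ∃ C : ℝ, 0 < C ∧ ∀ (M : ℕ) (s : Finset (ℤ × ℤ)),
      (∀ q ∈ s, q.1 ^ 2 + q.1 * q.2 + q.2 ^ 2 = M) → (s.card : ℝ) ≤ C * (1 + M : ℝ) ^ ε := by
  obtain ⟨U, hU, hcard⟩ := exists_card_le_of_sq_add_mul_add_sq_eq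
  obtain ⟨C, hC, hprod⟩ := exists_prod_primeFactors_le_rpow U hU hε
  refine ⟨max 1 (U * C), by positivity, fun M s hs ↦ ?_⟩
  rcases eq_or_ne M 0 with rfl | hM
  · have hsub : s ⊆ {(0, 0)} := fun q hq ↦ by
      have h := hs q hq
      push_cast at h
      have h2 : q.2 ^ 2 = 0 :=
        le_antisymm (by nlinarith [sq_nonneg (2 * q.1 + q.2)]) (sq_nonneg _)
      have h1 : q.1 ^ 2 = 0 :=
        le_antisymm (by nlinarith [sq_nonneg (q.1 + 2 * q.2)]) (sq_nonneg _)
      rw [Finset.mem_singleton]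
      exact Prod.ext (by simpa using h1) (by simpa using h2)
    have : s.card ≤ 1 := by simpa using Finset.card_le_card hsub
    simpa using Or.inl this
  · calc (s.card : ℝ)
        ≤ U * ∏ p ∈ M.primeFactors, ((U : ℝ) * (M.factorization p + 1)) ^ 2 := by
          exact_mod_cast hcard M hM s hs
      _ ≤ U * (C * (M : ℝ) ^ ε) := by gcongr; exact hprod M hM
      _ = U * C * (M : ℝ) ^ ε := by ring
      _ ≤ max 1 (U * C) * (1 + M : ℝ) ^ ε := by
          gcongr
          · exact le_max_right _ _
          · linarith

/-- Bound for the number of integer points on the circle cut out of a sphere by a plane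
`m₁ + m₂ + m₃ = n`. -/
theorem exists_card_le_rpow_of_sum_sq_eq {ε : ℝ} (hε : 0 < ε) :
    ∃ C : ℝ, 0 < C ∧ ∀ (n k : ℤ), 0 ≤ k → ∀ s : Finset (ℤ × ℤ),
      (∀ m ∈ s, m.1 ^ 2 + m.2 ^ 2 + (n - m.1 - m.2) ^ 2 = k) →
        (s.card : ℝ) ≤ C * (1 + k : ℝ) ^ ε := by
  obtain ⟨C, hC, hcard⟩ := exists_card_le_rpow_of_sq_add_mul_add_sq_eq hε
  refine ⟨C * 5 ^ ε, by positivity, fun n k hk s hs ↦ ?_⟩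
  have hk' : (0 : ℝ) ≤ 1 + k := by exact_mod_cast hk.trans (by omega : k ≤ 1 + k)
  rcases s.eq_empty_or_nonempty with rfl | ⟨m₀, hm₀⟩
  · simp only [Finset.card_empty, Nat.cast_zero]
    positivity
  set N : ℤ × ℤ → ℤ := fun m ↦
    (3 * m.1 - n) ^ 2 + (3 * m.1 - n) * (3 * m.2 - n) + (3 * m.2 - n) ^ 2 with hN
  have hNk : ∀ m ∈ s, 2 * N m = 9 * k - 3 * n ^ 2 := fun m hm ↦ by
    rw [← hs m hm, hN]
    ring
  have hN0 : 0 ≤ N m₀ := by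
    have : 0 ≤ 4 * N m₀ := by
      have : 4 * N m₀ = (2 * (3 * m₀.1 - n) + (3 * m₀.2 - n)) ^ 2 + 3 * (3 * m₀.2 - n) ^ 2 := by
        simp only [hN]; ring
      rw [this]; positivity
    omega
  obtain ⟨M, hM⟩ := Int.eq_ofNat_of_zero_le hN0
  have hinj : Function.Injective fun m : ℤ × ℤ ↦ (3 * m.1 - n, 3 * m.2 - n) := by
    rintro ⟨a, b⟩ ⟨c, d⟩ h
    simp only [Prod.mk.injEq] at h
    ext <;> simp <;> omega
  have h := hcard M (s.image fun m ↦ (3 * m.1 - n, 3 * m.2 - n)) fun q hq ↦ by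
    obtain ⟨m, hm, rfl⟩ := Finset.mem_image.1 hq
    have h1 := hNk m hm
    have h2 := hNk m₀ hm₀
    change N m = M
    omega
  rw [Finset.card_image_of_injective s hinj] at h
  have hMk : (1 + M : ℤ) ≤ 5 * (1 + k) := by
    have := hNk m₀ hm₀
    nlinarith [sq_nonneg n]
  have hMk' : (1 + M : ℝ) ≤ 5 * (1 + k) := by exact_mod_cast hMk
  calc (s.card : ℝ) ≤ C * (1 + M : ℝ) ^ ε := h
    _ ≤ C * (5 * (1 + k : ℝ)) ^ ε := by gcongr
    _ = _ := by rw [Real.mul_rpow (by norm_num) hk', mul_assoc]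

end DivisorBound

section Bracket

theorem jb_pos (x : ℝ) : 0 < jb x := Real.sqrt_pos.2 (by positivity)

theorem measurable_jb : Measurable jb := by
  unfold jb
  fun_prop

theorem jb_rpow (x s : ℝ) : jb x ^ s = (1 + x ^ 2) ^ (s / 2) := by
  rw [jb, Real.sqrt_eq_rpow, ← Real.rpow_mul (by positivity)]
  ring_nf

theorem jb_le_two_mul_jb_add {x : ℝ} (hx : |x| ≤ 1) (y : ℝ) : jb y ≤ 2 * jb (x + y) := by
  have hx2 : x ^ 2 ≤ 1 := (sq_le_one_iff_abs_le_one x).2 hx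
  rw [jb, jb, Real.sqrt_le_left (by positivity), mul_pow, Real.sq_sqrt (by positivity)]
  nlinarith [sq_nonneg (2 * x + y)]

/-- The negative power `⟨x⟩ ^ (-s)` with values in `ℝ≥0∞`. -/
noncomputable def jbInv (s x : ℝ) : ℝ≥0∞ := ENNReal.ofReal (jb x ^ (-s))

theorem measurable_jbInv (s : ℝ) : Measurable (jbInv s) :=
  (measurable_jb.pow_const _).ennreal_ofReal

theorem lintegral_jbInv_ne_top {s : ℝ} (hs : 1 < s) : ∫⁻ x, jbInv s x ≠ ∞ := by
  have h := integrable_rpow_neg_one_add_norm_sq (E := ℝ) (μ := volume) (r := s) (by simpa using hs)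
  simp only [jbInv, jb_rpow]
  simpa using h.lintegral_lt_top.ne

theorem tsum_jbInv_ne_top {s : ℝ} (hs : 1 < s) : ∑' k : ℤ, jbInv s k ≠ ∞ := by
  have h : Summable fun k : ℤ ↦ jb k ^ (-s) := by
    refine Summable.of_norm_bounded_eventually (Real.summable_abs_int_rpow hs) ?_
    filter_upwards [(Set.finite_singleton (0 : ℤ)).compl_mem_cofinite] with k hk
    have hk0 : (0 : ℝ) < |(k : ℝ)| := abs_pos.2 (by exact_mod_cast hk)
    rw [Real.norm_of_nonneg (Real.rpow_nonneg (jb_pos _).le _)]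
    refine Real.rpow_le_rpow_of_nonpos hk0 ?_ (by linarith)
    exact Real.le_sqrt_of_sq_le (by rw [sq_abs]; linarith)
  exact h.tsum_ofReal_ne_top

theorem exists_tsum_jbInv_add_le {s : ℝ} (hs : 1 < s) :
    ∃ C : ℝ≥0∞, C ≠ ∞ ∧ ∀ x : ℝ, ∑' k : ℤ, jbInv s (x + k) ≤ C := by
  refine ⟨ENNReal.ofReal (2 ^ s) * ∑' k : ℤ, jbInv s k,
    ENNReal.mul_ne_top ENNReal.ofReal_ne_top (tsum_jbInv_ne_top hs), fun x ↦ ?_⟩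
  rw [← (Equiv.subRight ⌊x⌋).tsum_eq, ← ENNReal.tsum_mul_left]
  refine ENNReal.tsum_le_tsum fun k ↦ ?_
  have hfract : x + ((k - ⌊x⌋ : ℤ) : ℝ) = Int.fract x + k := by
    rw [Int.fract]; push_cast; ring
  rw [Equiv.subRight_apply, hfract, jbInv, jbInv, ← ENNReal.ofReal_mul (by positivity)]
  refine ENNReal.ofReal_le_ofReal ?_
  have habs : |Int.fract x| ≤ 1 := by
    rw [abs_of_nonneg (Int.fract_nonneg x)]
    exact (Int.fract_lt_one x).le
  have hpos := jb_pos (Int.fract x + k)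
  calc jb (Int.fract x + k) ^ (-s) = 2 ^ s * (2 * jb (Int.fract x + k)) ^ (-s) := by
        rw [Real.mul_rpow two_pos.le hpos.le, ← mul_assoc, ← Real.rpow_add two_pos,
          add_neg_cancel, Real.rpow_zero, one_mul]
    _ ≤ 2 ^ s * jb k ^ (-s) := by
        gcongr ?_ * ?_
        exact Real.rpow_le_rpow_of_nonpos (jb_pos _) (jb_le_two_mul_jb_add habs _) (by linarith)

theorem jbInv_mul_jbInv_mul_jbInv_le {σ : ℝ} (hσ : 0 ≤ σ) (x y z : ℝ) :
    jbInv (2 * σ) x * jbInv (2 * σ) y * jbInv (2 * σ) z ≤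
      ENNReal.ofReal ((1 + (x ^ 2 + y ^ 2 + z ^ 2)) ^ (-σ)) := by
  simp only [jbInv, jb_rpow]
  rw [← ENNReal.ofReal_mul (by positivity), ← ENNReal.ofReal_mul (by positivity),
    ← Real.mul_rpow (by positivity) (by positivity),
    ← Real.mul_rpow (by positivity) (by positivity), show -(2 * σ) / 2 = -σ by ring]
  refine ENNReal.ofReal_le_ofReal
    (Real.rpow_le_rpow_of_nonpos (by positivity) ?_ (by linarith))
  have h1 : 0 ≤ x ^ 2 * y ^ 2 + x ^ 2 * z ^ 2 + y ^ 2 * z ^ 2 + x ^ 2 * y ^ 2 * z ^ 2 := by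
    positivity
  linarith

theorem exists_tsum_jbInv_mul_le {σ : ℝ} (hσ : 0 < σ) :
    ∃ C : ℝ≥0∞, C ≠ ∞ ∧ ∀ (n : ℤ) (ψ : ℤ → ℝ≥0∞),
      ∑' m : ℤ × ℤ, jbInv (2 * σ) m.1 * jbInv (2 * σ) m.2 * jbInv (2 * σ) (n - m.1 - m.2 : ℤ) *
        ψ (m.1 ^ 2 + m.2 ^ 2 + (n - m.1 - m.2) ^ 2) ≤ C * ∑' k, ψ k := by
  obtain ⟨C, hC, hcard⟩ := exists_card_le_rpow_of_sum_sq_eq hσ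
  refine ⟨ENNReal.ofReal C, ENNReal.ofReal_ne_top, fun n ψ ↦ ?_⟩
  rw [← ENNReal.tsum_fiberwise _ fun m : ℤ × ℤ ↦ m.1 ^ 2 + m.2 ^ 2 + (n - m.1 - m.2) ^ 2,
    ← ENNReal.tsum_mul_left]
  refine ENNReal.tsum_le_tsum fun k ↦ ?_
  rw [ENNReal.tsum_eq_iSup_sum]
  refine iSup_le fun s ↦ ?_
  rcases s.eq_empty_or_nonempty with rfl | ⟨m₀, -⟩
  · simp
  have hk : 0 ≤ k := by
    have h : _ = k := m₀.2
    rw [← h]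
    positivity
  have hk' : (0 : ℝ) < 1 + k := by exact_mod_cast (by omega : 0 < 1 + k)
  have hs : (s.card : ℝ) ≤ C * (1 + k : ℝ) ^ σ := by
    have h := hcard n k hk (s.map (Function.Embedding.subtype _)) fun m hm ↦ by
      obtain ⟨m', -, rfl⟩ := Finset.mem_map.1 hm
      exact m'.2
    rwa [Finset.card_map] at h
  calc _ ≤ ∑ _m ∈ s, ENNReal.ofReal ((1 + k : ℝ) ^ (-σ)) * ψ k := by
        refine Finset.sum_le_sum fun m _ ↦ ?_
        have h : m.1.1 ^ 2 + m.1.2 ^ 2 + (n - m.1.1 - m.1.2) ^ 2 = k := m.2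
        rw [h]
        gcongr
        refine (jbInv_mul_jbInv_mul_jbInv_le hσ.le _ _ _).trans_eq ?_
        have h' : (k : ℝ) = m.1.1 ^ 2 + m.1.2 ^ 2 + ((n - m.1.1 - m.1.2 : ℤ) : ℝ) ^ 2 := by
          exact_mod_cast h.symm
        rw [h']
    _ = ENNReal.ofReal (s.card * (1 + k : ℝ) ^ (-σ)) * ψ k := by
        rw [Finset.sum_const, nsmul_eq_mul, ENNReal.ofReal_mul (by positivity),
          ENNReal.ofReal_natCast, mul_assoc]
    _ ≤ ENNReal.ofReal C * ψ k := by
        gcongr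
        calc (s.card : ℝ) * (1 + k : ℝ) ^ (-σ)
            ≤ C * (1 + k : ℝ) ^ σ * (1 + k : ℝ) ^ (-σ) := by gcongr
          _ = C := by
            rw [mul_assoc, ← Real.rpow_add hk', add_neg_cancel, Real.rpow_zero, mul_one]

end Bracket

section Convolution

theorem lintegral_sq_le_mul {α : Type*} [MeasurableSpace α] (μ : Measure α)
    {F G H : α → ℝ≥0∞} (hG : Measurable G) (hH : Measurable H) (h : ∀ x, F x ^ 2 = G x * H x) :
    (∫⁻ x, F x ∂μ) ^ 2 ≤ (∫⁻ x, G x ∂μ) * ∫⁻ x, H x ∂μ := by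
  have hF : ∀ x, F x = G x ^ (1 / 2 : ℝ) * H x ^ (1 / 2 : ℝ) := fun x ↦ by
    rw [← ENNReal.mul_rpow_of_nonneg _ _ (by norm_num), ← h, ← ENNReal.rpow_natCast,
      ← ENNReal.rpow_mul]
    norm_num
  have hsq : ∀ a : ℝ≥0∞, (a ^ (1 / 2 : ℝ)) ^ (2 : ℝ) = a := fun a ↦ by
    rw [← ENNReal.rpow_mul]
    norm_num
  have hCS := ENNReal.lintegral_mul_le_Lp_mul_Lq μ Real.HolderConjugate.two_two
    (hG.pow_const (1 / 2 : ℝ)).aemeasurable (hH.pow_const (1 / 2 : ℝ)).aemeasurable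
  simp only [hsq, Pi.mul_apply, ← hF] at hCS
  calc (∫⁻ x, F x ∂μ) ^ 2
      ≤ ((∫⁻ x, G x ∂μ) ^ (1 / 2 : ℝ) * (∫⁻ x, H x ∂μ) ^ (1 / 2 : ℝ)) ^ 2 := by gcongr
    _ = _ := by
      rw [← ENNReal.rpow_natCast, ENNReal.mul_rpow_of_nonneg _ _ (by norm_num)]
      exact congrArg₂ _ (hsq _) (hsq _)

theorem tsum_lintegral_sq_le_mul {ι α : Type*} [MeasurableSpace α] (μ : Measure α)
    {F G H : ι → α → ℝ≥0∞} (hG : ∀ i, Measurable (G i)) (hH : ∀ i, Measurable (H i))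
    (h : ∀ i x, F i x ^ 2 = G i x * H i x) :
    (∑' i, ∫⁻ x, F i x ∂μ) ^ 2 ≤ (∑' i, ∫⁻ x, G i x ∂μ) * ∑' i, ∫⁻ x, H i x ∂μ := by
  have hsq : ∀ a : ℝ≥0∞, (a ^ (1 / 2 : ℝ)) ^ 2 = a := fun a ↦ by
    rw [← ENNReal.rpow_natCast, ← ENNReal.rpow_mul]
    norm_num
  have hsq' : ∀ {a b : ℝ≥0∞}, a ^ 2 ≤ b → a ≤ b ^ (1 / 2 : ℝ) := fun {a b} hab ↦ by
    rwa [← ENNReal.rpow_natCast, ← ENNReal.le_rpow_inv_iff (by norm_num), Nat.cast_ofNat,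
      ← one_div] at hab
  let _ : MeasurableSpace ι := ⊤
  have hcount := lintegral_sq_le_mul (Measure.count : Measure ι)
    (F := fun i ↦ (∫⁻ x, G i x ∂μ) ^ (1 / 2 : ℝ) * (∫⁻ x, H i x ∂μ) ^ (1 / 2 : ℝ))
    (G := fun i ↦ ∫⁻ x, G i x ∂μ) (H := fun i ↦ ∫⁻ x, H i x ∂μ)
    measurable_from_top measurable_from_top fun i ↦ by rw [mul_pow, hsq, hsq]
  simp only [lintegral_count] at hcount
  refine le_trans ?_ hcount
  gcongr with i
  rw [← ENNReal.mul_rpow_of_nonneg _ _ (by norm_num)]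
  exact hsq' (lintegral_sq_le_mul μ (hG i) (hH i) (h i))

theorem tsum_lintegral_triple_convolution {G : ℤ × ℝ → ℝ≥0∞} (hG : Measurable G) :
    ∑' n : ℤ, ∫⁻ ξ : ℝ, ∑' m : ℤ × ℤ, ∫⁻ q : ℝ × ℝ,
      G (m.1, q.1) * G (m.2, q.2) * G (n - m.1 - m.2, ξ - q.1 - q.2) =
        (∑' n : ℤ, ∫⁻ ξ : ℝ, G (n, ξ)) ^ 3 := by
  have hGm : ∀ n : ℤ, Measurable fun ξ ↦ G (n, ξ) := fun n ↦ hG.comp measurable_prodMk_left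
  calc _ = ∑' m : ℤ × ℤ, ∑' n : ℤ, ∫⁻ ξ : ℝ, ∫⁻ q : ℝ × ℝ,
      G (m.1, q.1) * G (m.2, q.2) * G (n - m.1 - m.2, ξ - q.1 - q.2) := by
        rw [ENNReal.tsum_comm]
        refine tsum_congr fun n ↦ lintegral_tsum fun m ↦ Measurable.aemeasurable ?_
        exact Measurable.lintegral_prod_right' (f := fun p : ℝ × ℝ × ℝ ↦
          G (m.1, p.2.1) * G (m.2, p.2.2) * G (n - m.1 - m.2, p.1 - p.2.1 - p.2.2))
            (by fun_prop)
    _ = ∑' m : ℤ × ℤ, ∫⁻ q : ℝ × ℝ, G (m.1, q.1) * G (m.2, q.2) *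
          ∑' n : ℤ, ∫⁻ ξ : ℝ, G (n, ξ) := by
        refine tsum_congr fun m ↦ ?_
        have hmeas : ∀ n : ℤ, Measurable fun p : ℝ × ℝ × ℝ ↦
            G (m.1, p.2.1) * G (m.2, p.2.2) * G (n - m.1 - m.2, p.1 - p.2.1 - p.2.2) := by
          fun_prop
        calc _ = ∑' n : ℤ, ∫⁻ q : ℝ × ℝ, ∫⁻ ξ : ℝ,
              G (m.1, q.1) * G (m.2, q.2) * G (n - m.1 - m.2, ξ - q.1 - q.2) :=
              tsum_congr fun n ↦ lintegral_lintegral_swap (hmeas n).aemeasurable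
          _ = ∫⁻ q : ℝ × ℝ, ∑' n : ℤ, ∫⁻ ξ : ℝ,
              G (m.1, q.1) * G (m.2, q.2) * G (n - m.1 - m.2, ξ - q.1 - q.2) :=
              (lintegral_tsum fun n ↦ (hmeas n).lintegral_prod_left'.aemeasurable).symm
          _ = _ := by
              refine lintegral_congr fun q ↦ ?_
              have hshift : ∀ n : ℤ, ∫⁻ ξ : ℝ, G (n, ξ - q.1 - q.2) = ∫⁻ ξ : ℝ, G (n, ξ) :=
                fun n ↦ by
                  simp only [sub_sub]
                  exact lintegral_sub_right_eq_self (fun ξ ↦ G (n, ξ)) _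
              have hconst : ∀ n : ℤ, ∫⁻ ξ : ℝ,
                  G (m.1, q.1) * G (m.2, q.2) * G (n - m.1 - m.2, ξ - q.1 - q.2) =
                    G (m.1, q.1) * G (m.2, q.2) * ∫⁻ ξ : ℝ, G (n - (m.1 + m.2), ξ) := fun n ↦ by
                rw [lintegral_const_mul _ (by fun_prop), hshift, sub_sub]
              simp only [hconst]
              rw [ENNReal.tsum_mul_left]
              congr 1
              exact (Equiv.subRight (m.1 + m.2)).tsum_eq fun n ↦ ∫⁻ ξ : ℝ, G (n, ξ)
    _ = _ := by
        have hprod : ∀ m : ℤ × ℤ, ∫⁻ q : ℝ × ℝ, G (m.1, q.1) * G (m.2, q.2) *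
            ∑' n : ℤ, ∫⁻ ξ : ℝ, G (n, ξ) = (∫⁻ ξ : ℝ, G (m.1, ξ)) * (∫⁻ ξ : ℝ, G (m.2, ξ)) *
              ∑' n : ℤ, ∫⁻ ξ : ℝ, G (n, ξ) := fun m ↦ by
          rw [lintegral_mul_const _ (by fun_prop), Measure.volume_eq_prod,
            lintegral_prod_mul (hGm m.1).aemeasurable (hGm m.2).aemeasurable]
        simp only [hprod]
        rw [ENNReal.tsum_mul_right, ENNReal.tsum_prod
          (f := fun a b : ℤ ↦ (∫⁻ ξ : ℝ, G (a, ξ)) * ∫⁻ ξ : ℝ, G (b, ξ))]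
        simp only [ENNReal.tsum_mul_left, ENNReal.tsum_mul_right]
        ring

theorem exists_tsum_lintegral_jbInv_le {σ : ℝ} (hσ : 0 < σ) :
    ∃ C : ℝ≥0∞, C ≠ ∞ ∧ ∀ h : ℤ × ℝ → ℝ≥0∞,
      (∀ n ξ, h (n, ξ) = jbInv (2 * σ) n * jbInv (1 + 2 * σ) (ξ + (n : ℝ) ^ 2)) →
      ∀ (n : ℤ) (ξ : ℝ), ∑' m : ℤ × ℤ, ∫⁻ q : ℝ × ℝ,
        h (m.1, q.1) * h (m.2, q.2) * h (n - m.1 - m.2, ξ - q.1 - q.2) ≤ C := by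
  obtain ⟨C₁, hC₁, hsum⟩ := exists_tsum_jbInv_mul_le hσ
  obtain ⟨C₂, hC₂, htsum⟩ := exists_tsum_jbInv_add_le (s := 1 + 2 * σ) (by linarith)
  have hint := lintegral_jbInv_ne_top (s := 1 + 2 * σ) (by linarith)
  set φ := jbInv (1 + 2 * σ)
  have hφ : Measurable φ := measurable_jbInv _
  refine ⟨(∫⁻ x, φ x) * (∫⁻ x, φ x) * (C₁ * C₂),
    ENNReal.mul_ne_top (ENNReal.mul_ne_top hint hint) (ENNReal.mul_ne_top hC₁ hC₂),
    fun h hh n ξ ↦ ?_⟩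
  set α : ℤ × ℤ → ℝ≥0∞ := fun m ↦
    jbInv (2 * σ) m.1 * jbInv (2 * σ) m.2 * jbInv (2 * σ) (n - m.1 - m.2 : ℤ)
  set Q : ℤ × ℤ → ℤ := fun m ↦ m.1 ^ 2 + m.2 ^ 2 + (n - m.1 - m.2) ^ 2
  have hshift : ∀ m : ℤ × ℤ, ∫⁻ q : ℝ × ℝ,
      h (m.1, q.1) * h (m.2, q.2) * h (n - m.1 - m.2, ξ - q.1 - q.2) =
        ∫⁻ q : ℝ × ℝ, φ q.1 * φ q.2 * (α m * φ (ξ - q.1 - q.2 + Q m)) := fun m ↦ by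
    rw [← lintegral_add_right_eq_self
      (fun q : ℝ × ℝ ↦ φ q.1 * φ q.2 * (α m * φ (ξ - q.1 - q.2 + Q m)))
      ((m.1 : ℝ) ^ 2, (m.2 : ℝ) ^ 2)]
    refine lintegral_congr fun q ↦ ?_
    have harg : ξ - (q.1 + (m.1 : ℝ) ^ 2) - (q.2 + (m.2 : ℝ) ^ 2) + Q m =
        ξ - q.1 - q.2 + ((n - m.1 - m.2 : ℤ) : ℝ) ^ 2 := by
      simp only [Q]
      push_cast
      ring
    simp only [hh, Prod.fst_add, Prod.snd_add, harg, α]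
    ring
  calc _ = ∫⁻ q : ℝ × ℝ, φ q.1 * φ q.2 * ∑' m, α m * φ (ξ - q.1 - q.2 + Q m) := by
        simp only [hshift]
        rw [← lintegral_tsum fun m ↦ by fun_prop]
        simp only [ENNReal.tsum_mul_left]
    _ ≤ ∫⁻ q : ℝ × ℝ, φ q.1 * φ q.2 * (C₁ * C₂) := by
        refine lintegral_mono fun q ↦ ?_
        gcongr
        exact (hsum n fun k ↦ φ (ξ - q.1 - q.2 + k)).trans (by gcongr; exact htsum _)
    _ = _ := by
        rw [lintegral_mul_const _ (by fun_prop), Measure.volume_eq_prod,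
          lintegral_prod_mul hφ.aemeasurable hφ.aemeasurable]

end Convolution

/-- The `L⁶` spacetime Strichartz estimate with derivative loss for the periodic
Schrödinger group, in spacetime Fourier variables: for `σ ∈ (0, 1/2]` there is `C > 0`
such that for every measurable nonnegative `f : ℤ × ℝ → [0,∞)`,
`∑_n ∫ (f∗f∗f)(n,ξ)² dξ ≤ C (∑_n ∫ ⟨n⟩^{2σ} ⟨ξ+n²⟩^{1+2σ} f(n,ξ)² dξ)³`. -/
theorem strichartz_L6_fourier (σ : ℝ) (hσ₁ : 0 < σ) (hσ₂ : σ ≤ 1 / 2) :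
    ∃ C : ℝ, 0 < C ∧ ∀ f : ℤ × ℝ → ℝ, Measurable f → (∀ x, 0 ≤ f x) →
      (∑' n : ℤ, ∫⁻ ξ : ℝ,
          (∑' m : ℤ × ℤ, ∫⁻ q : ℝ × ℝ,
            ENNReal.ofReal (f (m.1, q.1)) * ENNReal.ofReal (f (m.2, q.2)) *
              ENNReal.ofReal (f (n - m.1 - m.2, ξ - q.1 - q.2))) ^ 2)
        ≤ ENNReal.ofReal C *
          (∑' n : ℤ, ∫⁻ ξ : ℝ, ENNReal.ofReal
            (jb (n : ℝ) ^ (2 * σ) * jb (ξ + (n : ℝ) ^ 2) ^ (1 + 2 * σ) *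
              f (n, ξ) ^ 2)) ^ 3 := by
  obtain ⟨C, hC, hbound⟩ := exists_tsum_lintegral_jbInv_le hσ₁
  refine ⟨C.toReal + 1, by positivity, fun f hf hf0 ↦ ?_⟩
  set h : ℤ × ℝ → ℝ≥0∞ := fun p ↦
    jbInv (2 * σ) p.1 * jbInv (1 + 2 * σ) (p.2 + (p.1 : ℝ) ^ 2) with hh
  set G : ℤ × ℝ → ℝ≥0∞ := fun p ↦ ENNReal.ofReal
    (jb (p.1 : ℝ) ^ (2 * σ) * jb (p.2 + (p.1 : ℝ) ^ 2) ^ (1 + 2 * σ) * f p ^ 2) with hG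
  have hjb : Measurable jb := measurable_jb
  have hjbInv : ∀ s, Measurable (jbInv s) := measurable_jbInv
  have hhm : Measurable h := by fun_prop
  have hGm : Measurable G := by fun_prop
  have hfG : ∀ p, ENNReal.ofReal (f p) ^ 2 = h p * G p := fun p ↦ by
    have h1 := jb_pos (p.1 : ℝ)
    have h2 := jb_pos (p.2 + (p.1 : ℝ) ^ 2)
    simp only [hh, hG, jbInv]
    rw [← ENNReal.ofReal_mul (by positivity), ← ENNReal.ofReal_mul (by positivity),
      ← ENNReal.ofReal_pow (hf0 p), Real.rpow_neg h1.le, Real.rpow_neg h2.le]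
    congr 1
    field_simp
  calc _ ≤ ∑' n : ℤ, ∫⁻ ξ : ℝ, C * ∑' m : ℤ × ℤ, ∫⁻ q : ℝ × ℝ,
        G (m.1, q.1) * G (m.2, q.2) * G (n - m.1 - m.2, ξ - q.1 - q.2) := by
        refine ENNReal.tsum_le_tsum fun n ↦ lintegral_mono fun ξ ↦ ?_
        refine (tsum_lintegral_sq_le_mul volume
          (G := fun m q ↦ h (m.1, q.1) * h (m.2, q.2) * h (n - m.1 - m.2, ξ - q.1 - q.2))
          (H := fun m q ↦ G (m.1, q.1) * G (m.2, q.2) * G (n - m.1 - m.2, ξ - q.1 - q.2))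
          (fun m ↦ by fun_prop) (fun m ↦ by fun_prop) fun m q ↦ ?_).trans ?_
        · rw [mul_pow, mul_pow, hfG, hfG, hfG]
          ring
        · gcongr
          exact hbound h (fun _ _ ↦ rfl) n ξ
    _ = C * (∑' n : ℤ, ∫⁻ ξ : ℝ, G (n, ξ)) ^ 3 := by
        simp only [lintegral_const_mul' _ _ hC]
        rw [ENNReal.tsum_mul_left, tsum_lintegral_triple_convolution hGm]
    _ ≤ _ := by
        gcongr
        exact (ENNReal.ofReal_toReal hC).symm.le.trans (ENNReal.ofReal_le_ofReal (by linarith))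
end

section
/- For every ε > 0 there exists a constant C > 0 such that for every natural number d, every n ∈ ℤ and every S ∈ ℤ, the number of triples (n₁, n₂, n₃) ∈ ℤ³ satisfying |n₁| ≤ 2^d, |n₂| ≤ 2^d, |n₃| ≤ 2^d, n₁ + n₂ + n₃ = n and n₁² + n₂² + n₃² = S is at most C · 2^{εd}. -/
open UniqueFactorizationMonoid NumberField

/-- Linear growth is dominated by exponential growth, with a constant that may be taken to be `1`
once the base is large. -/
lemma exists_natCast_add_one_le_rpow {ε : ℝ} (hε : 0 < ε) :
    ∃ K : ℝ, 1 ≤ K ∧ ∃ B : ℕ, ∀ q : ℕ, 2 ≤ q → ∀ e : ℕ,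
      (e + 1 : ℝ) ≤ (if q ≤ B then K else 1) * ((q : ℝ) ^ e) ^ ε := by
  have hlog : 0 < ε * Real.log 2 := by positivity
  refine ⟨max 1 (1 / (ε * Real.log 2)), le_max_left _ _, ⌈(2 : ℝ) ^ (1 / ε)⌉₊, fun q hq e ↦ ?_⟩
  have hq2 : (2 : ℝ) ≤ q := by exact_mod_cast hq
  split_ifs with h
  · set K := max 1 (1 / (ε * Real.log 2))
    have hK : 1 ≤ K * (ε * Real.log 2) := by
      rw [← div_le_iff₀ hlog]
      exact le_max_right _ _
    have h1 : e * (ε * Real.log 2) + 1 ≤ ((q : ℝ) ^ e) ^ ε := calc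
      e * (ε * Real.log 2) + 1 ≤ Real.exp (e * (ε * Real.log 2)) := Real.add_one_le_exp _
      _ = ((2 : ℝ) ^ e) ^ ε := by
        rw [Real.rpow_def_of_pos (by positivity), Real.log_pow]
        ring_nf
      _ ≤ ((q : ℝ) ^ e) ^ ε := by gcongr
    have hK1 : 1 ≤ K := le_max_left _ _
    have he : (0 : ℝ) ≤ e := by positivity
    nlinarith [mul_le_mul_of_nonneg_left h1 (zero_le_one.trans hK1),
      mul_le_mul_of_nonneg_left hK he]
  · have hq' : (2 : ℝ) ^ (1 / ε) ≤ q :=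
      (Nat.le_ceil _).trans (by exact_mod_cast (not_le.mp h).le)
    have h2 : (2 : ℝ) ≤ (q : ℝ) ^ ε := calc
      (2 : ℝ) = ((2 : ℝ) ^ (1 / ε)) ^ ε := by
        rw [← Real.rpow_mul (by norm_num), one_div_mul_cancel hε.ne', Real.rpow_one]
      _ ≤ (q : ℝ) ^ ε := by gcongr
    calc (e + 1 : ℝ) ≤ (2 : ℝ) ^ e := by exact_mod_cast Nat.lt_two_pow_self
      _ ≤ ((q : ℝ) ^ ε) ^ e := by gcongr
      _ = ((q : ℝ) ^ e) ^ ε := by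
        rw [← Real.rpow_natCast_mul (by positivity), ← Real.rpow_mul_natCast (by positivity),
          mul_comm]
      _ = 1 * ((q : ℝ) ^ e) ^ ε := (one_mul _).symm

section Ideal

variable {R : Type*} [CommRing R] [IsDedekindDomain R]

open Classical in
lemma finite_and_ncard_setOf_ideal_dvd_le {I : Ideal R} (hI : I ≠ 0) :
    {J : Ideal R | J ∣ I}.Finite ∧ {J : Ideal R | J ∣ I}.ncard ≤
      ∏ P ∈ (normalizedFactors I).toFinset, ((normalizedFactors I).count P + 1) := by
  have hmaps : Set.MapsTo normalizedFactors {J : Ideal R | J ∣ I}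
      (Finset.Iic (normalizedFactors I) : Finset (Multiset (Ideal R))) := fun J hJ ↦ by
    simpa using (dvd_iff_normalizedFactors_le_normalizedFactors (ne_zero_of_dvd_ne_zero hI hJ)
      hI).mp hJ
  have hinj : Set.InjOn normalizedFactors {J : Ideal R | J ∣ I} := fun J hJ J' hJ' h ↦ by
    rw [← Ideal.prod_normalizedFactors_eq_self (ne_zero_of_dvd_ne_zero hI hJ), h,
      Ideal.prod_normalizedFactors_eq_self (ne_zero_of_dvd_ne_zero hI hJ')]
  refine ⟨Set.Finite.of_injOn hmaps hinj (Finset.finite_toSet _), ?_⟩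
  rw [← Multiset.card_Iic, ← Set.ncard_coe_finset]
  exact Set.ncard_le_ncard_of_injOn _ hmaps hinj (Finset.finite_toSet _)

open Classical in
/-- The divisor bound for ideals. -/
theorem exists_ncard_setOf_ideal_dvd_le_rpow [CharZero R] [Module.Finite ℤ R] [Module.Free ℤ R]
    {ε : ℝ} (hε : 0 < ε) :
    ∃ C : ℝ, 0 < C ∧ ∀ I : Ideal R, I ≠ 0 →
      ({J : Ideal R | J ∣ I}.ncard : ℝ) ≤ C * (Ideal.absNorm I : ℝ) ^ ε := by
  obtain ⟨K, hK, B, h⟩ := exists_natCast_add_one_le_rpow hε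
  have hfin := Ideal.finite_setOfPred_absNorm_le (S := R) B
  refine ⟨K ^ hfin.toFinset.card, by positivity, fun I hI ↦ ?_⟩
  set s := normalizedFactors I with hs
  have hnorm : (Ideal.absNorm I : ℝ) = ∏ P ∈ s.toFinset, (Ideal.absNorm P : ℝ) ^ s.count P := by
    conv_lhs => rw [← Ideal.prod_normalizedFactors_eq_self hI, ← hs, Finset.prod_multiset_count]
    simp
  calc ({J : Ideal R | J ∣ I}.ncard : ℝ) ≤ ∏ P ∈ s.toFinset, (s.count P + 1 : ℝ) := by
        exact_mod_cast (finite_and_ncard_setOf_ideal_dvd_le hI).2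
    _ ≤ ∏ P ∈ s.toFinset, (if Ideal.absNorm P ≤ B then K else 1) *
          ((Ideal.absNorm P : ℝ) ^ s.count P) ^ ε := by
        refine Finset.prod_le_prod (fun _ _ ↦ by positivity) fun P hP ↦ h _ ?_ _
        have hP' := prime_of_normalized_factor P (Multiset.mem_toFinset.mp hP)
        have h0 : Ideal.absNorm P ≠ 0 := mt Ideal.absNorm_eq_zero_iff.mp hP'.ne_zero
        have h1 : Ideal.absNorm P ≠ 1 :=
          fun h ↦ hP'.not_isUnit (Ideal.isUnit_iff.mpr (Ideal.absNorm_eq_one_iff.mp h))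
        omega
    _ = K ^ (s.toFinset.filter fun P ↦ Ideal.absNorm P ≤ B).card *
          (Ideal.absNorm I : ℝ) ^ ε := by
        rw [Finset.prod_mul_distrib, hnorm, Real.finsetProd_rpow _ _ fun _ _ ↦ by positivity,
          Finset.prod_ite, Finset.prod_const, Finset.prod_const_one, mul_one]
    _ ≤ K ^ hfin.toFinset.card * (Ideal.absNorm I : ℝ) ^ ε := by
        gcongr ?_ * _
        refine pow_le_pow_right₀ hK (Finset.card_le_card fun P ↦ ?_)
        simp

end Ideal

section Elements

variable {R : Type*} [CommRing R] [IsDedekindDomain R]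

lemma setOf_dvd_subset_image_generator (x : R) :
    {z : R | z ∣ x} ⊆ (fun p : Ideal R × Rˣ ↦
      Function.invFun (fun z : R ↦ Ideal.span {z}) p.1 * p.2) ''
        ({J : Ideal R | J ∣ Ideal.span {x}} ×ˢ Set.univ) := by
  intro z hz
  obtain ⟨u, hu⟩ : Associated (Function.invFun (fun z : R ↦ Ideal.span {z}) (Ideal.span {z})) z :=
    Ideal.span_singleton_eq_span_singleton.mp
      (Function.invFun_eq (f := fun z : R ↦ Ideal.span {z}) ⟨z, rfl⟩)
  exact ⟨(Ideal.span {z}, u), ⟨Ideal.dvd_iff_le.mpr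
    (Ideal.span_singleton_le_span_singleton.mpr hz), trivial⟩, hu⟩

lemma finite_setOf_dvd_of_finite_units [Finite Rˣ] {x : R} (hx : x ≠ 0) : {z : R | z ∣ x}.Finite :=
  (((finite_and_ncard_setOf_ideal_dvd_le (by simpa using hx)).1.prod Set.finite_univ).image
    _).subset
    (setOf_dvd_subset_image_generator x)

/-- The divisor bound for the elements of a Dedekind domain with finitely many units. -/
theorem exists_ncard_setOf_dvd_le_rpow [Finite Rˣ] [CharZero R] [Module.Finite ℤ R]
    [Module.Free ℤ R] {ε : ℝ} (hε : 0 < ε) :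
    ∃ C : ℝ, 0 < C ∧ ∀ x : R, x ≠ 0 →
      ({z : R | z ∣ x}.ncard : ℝ) ≤ C * ((Algebra.norm ℤ x).natAbs : ℝ) ^ ε := by
  obtain ⟨C, hC, h⟩ := exists_ncard_setOf_ideal_dvd_le_rpow (R := R) hε
  refine ⟨C * Nat.card Rˣ, mul_pos hC (by exact_mod_cast Nat.card_pos), fun x hx ↦ ?_⟩
  have hI : Ideal.span {x} ≠ 0 := by simpa using hx
  have hfin := (finite_and_ncard_setOf_ideal_dvd_le hI).1.prod (Set.finite_univ (α := Rˣ))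
  have hle : {z : R | z ∣ x}.ncard ≤ {J : Ideal R | J ∣ Ideal.span {x}}.ncard * Nat.card Rˣ := by
    rw [← Set.ncard_univ, ← Set.ncard_prod]
    exact (Set.ncard_le_ncard (setOf_dvd_subset_image_generator x) (hfin.image _)).trans
      (Set.ncard_image_le hfin)
  calc ({z : R | z ∣ x}.ncard : ℝ)
      ≤ {J : Ideal R | J ∣ Ideal.span {x}}.ncard * Nat.card Rˣ := by exact_mod_cast hle
    _ ≤ C * ((Algebra.norm ℤ x).natAbs : ℝ) ^ ε * Nat.card Rˣ := by
        gcongr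
        rw [← Ideal.absNorm_span_singleton]
        exact h _ hI
    _ = C * Nat.card Rˣ * ((Algebra.norm ℤ x).natAbs : ℝ) ^ ε := by ring

end Elements

section Eisenstein

variable {K : Type*} [Field K]

lemma finite_units_of_isCyclotomicExtension_three [NumberField K] [IsCyclotomicExtension {3} ℚ K] :
    Finite (𝓞 K)ˣ :=
  Set.finite_univ_iff.mp ((List.finite_toSet _).subset fun u _ ↦
    IsCyclotomicExtension.Rat.Three.Units.mem (IsCyclotomicExtension.zeta_spec 3 ℚ K) u)

/-- The norm form `a² - ab + b²` factors as `(a + b ω) (a + b ω²)`. -/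
lemma IsPrimitiveRoot.add_mul_dvd_of_normForm {ζ : K} (hζ : IsPrimitiveRoot ζ 3) {a b N : ℤ}
    (h : a ^ 2 - a * b + b ^ 2 = N) : (a + b * hζ.toInteger : 𝓞 K) ∣ N := by
  have hz := IsCyclotomicExtension.Rat.Three.eta_sq_add_eta_add_one hζ
  rw [IsCyclotomicExtension.Rat.Three.coe_eta] at hz
  refine ⟨a + b * hζ.toInteger ^ 2, ?_⟩
  rw [← h]
  push_cast
  linear_combination (-(a * b) - b ^ 2 * (hζ.toInteger - 1) : 𝓞 K) * hz

lemma IsPrimitiveRoot.add_mul_injective [CharZero K] {ζ : K} (hζ : IsPrimitiveRoot ζ 3) :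
    Function.Injective fun p : ℤ × ℤ ↦ (p.1 + p.2 * hζ.toInteger : 𝓞 K) := by
  have hz := IsCyclotomicExtension.Rat.Three.eta_sq_add_eta_add_one hζ
  rw [IsCyclotomicExtension.Rat.Three.coe_eta] at hz
  rintro ⟨a, b⟩ ⟨a', b'⟩ h
  have h' : (((a - a') ^ 2 - (a - a') * (b - b') + (b - b') ^ 2 : ℤ) : 𝓞 K) = 0 := by
    push_cast
    linear_combination ((a - a') + (b - b') * hζ.toInteger ^ 2 : 𝓞 K) * h +
      ((a - a') * (b - b') + (b - b') ^ 2 * (hζ.toInteger - 1) : 𝓞 K) * (-hz)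
  have h0 : (a - a') ^ 2 - (a - a') * (b - b') + (b - b') ^ 2 = 0 := by exact_mod_cast h'
  have hb : (b - b') ^ 2 = 0 := by
    nlinarith [sq_nonneg (2 * (a - a') - (b - b')), sq_nonneg (b - b')]
  have ha : (a - a') ^ 2 = 0 := by
    nlinarith [sq_nonneg (2 * (b - b') - (a - a')), sq_nonneg (a - a')]
  rw [sq_eq_zero_iff, sub_eq_zero] at ha hb
  rw [ha, hb]

end Eisenstein

/-- The number of representations of `N ≠ 0` by `a² - ab + b²` is `O(|N| ^ ε)`. -/
theorem exists_ncard_normForm_le_rpow {ε : ℝ} (hε : 0 < ε) :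
    ∃ C : ℝ, 0 < C ∧ ∀ N : ℤ, N ≠ 0 →
      {p : ℤ × ℤ | p.1 ^ 2 - p.1 * p.2 + p.2 ^ 2 = N}.Finite ∧
      ({p : ℤ × ℤ | p.1 ^ 2 - p.1 * p.2 + p.2 ^ 2 = N}.ncard : ℝ) ≤ C * (N.natAbs : ℝ) ^ ε := by
  have : IsCyclotomicExtension {3} ℚ (CyclotomicField 3 ℚ) :=
    CyclotomicField.isCyclotomicExtension 3 ℚ
  have hζ := IsCyclotomicExtension.zeta_spec 3 ℚ (CyclotomicField 3 ℚ)
  have : Finite (𝓞 (CyclotomicField 3 ℚ))ˣ := finite_units_of_isCyclotomicExtension_three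
  have hk : 0 < Module.finrank ℤ (𝓞 (CyclotomicField 3 ℚ)) := Module.finrank_pos
  obtain ⟨C, hC, h⟩ := exists_ncard_setOf_dvd_le_rpow (R := 𝓞 (CyclotomicField 3 ℚ))
    (ε := ε / Module.finrank ℤ (𝓞 (CyclotomicField 3 ℚ))) (by positivity)
  refine ⟨C, hC, fun N hN ↦ ?_⟩
  have hN' : (N : 𝓞 (CyclotomicField 3 ℚ)) ≠ 0 := by exact_mod_cast hN
  have hfin := finite_setOf_dvd_of_finite_units hN'
  have hmaps : ∀ p ∈ {p : ℤ × ℤ | p.1 ^ 2 - p.1 * p.2 + p.2 ^ 2 = N},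
      (p.1 + p.2 * hζ.toInteger : 𝓞 (CyclotomicField 3 ℚ)) ∈
        {z : 𝓞 (CyclotomicField 3 ℚ) | z ∣ N} :=
    fun p hp ↦ hζ.add_mul_dvd_of_normForm hp
  refine ⟨Set.Finite.of_injOn hmaps hζ.add_mul_injective.injOn hfin, ?_⟩
  calc ({p : ℤ × ℤ | p.1 ^ 2 - p.1 * p.2 + p.2 ^ 2 = N}.ncard : ℝ)
      ≤ {z : 𝓞 (CyclotomicField 3 ℚ) | z ∣ N}.ncard := by
        exact_mod_cast Set.ncard_le_ncard_of_injOn _ hmaps hζ.add_mul_injective.injOn hfin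
    _ ≤ _ := h _ hN'
    _ = C * (N.natAbs : ℝ) ^ ε := by
        rw [← eq_intCast (algebraMap ℤ (𝓞 (CyclotomicField 3 ℚ))), Algebra.norm_algebraMap,
          Int.natAbs_pow, Nat.cast_pow, ← Real.rpow_natCast_mul (by positivity),
          mul_div_cancel₀ _ (by positivity)]

/-- Divisor-type counting estimate for the periodic `L⁶` Strichartz estimate: for every
`ε > 0` there is `C > 0` so that for every `d`, `n`, `S`, the number of triples
`(n₁, n₂, n₃)` with `|nᵢ| ≤ 2^d`, `n₁ + n₂ + n₃ = n` and `n₁² + n₂² + n₃² = S` is at most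
`C · 2^(εd)`. -/
theorem strichartz_counting (ε : ℝ) (hε : 0 < ε) :
    ∃ C : ℝ, 0 < C ∧ ∀ (d : ℕ) (n S : ℤ),
      (({t : ℤ × ℤ × ℤ | |t.1| ≤ 2 ^ d ∧ |t.2.1| ≤ 2 ^ d ∧ |t.2.2| ≤ 2 ^ d ∧
          t.1 + t.2.1 + t.2.2 = n ∧ t.1 ^ 2 + t.2.1 ^ 2 + t.2.2 ^ 2 = S}).ncard : ℝ)
        ≤ C * (2 : ℝ) ^ (ε * d) := by
  obtain ⟨C, hC, hcount⟩ := exists_ncard_normForm_le_rpow (half_pos hε)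
  refine ⟨max 1 (C * 12 ^ (ε / 2)), by positivity, fun d n S ↦ ?_⟩
  set A := {t : ℤ × ℤ × ℤ | |t.1| ≤ 2 ^ d ∧ |t.2.1| ≤ 2 ^ d ∧ |t.2.2| ≤ 2 ^ d ∧
    t.1 + t.2.1 + t.2.2 = n ∧ t.1 ^ 2 + t.2.1 ^ 2 + t.2.2 ^ 2 = S}
  obtain hempty | ⟨⟨x, y, z⟩, hx, hy, hz, hn, hS⟩ := A.eq_empty_or_nonempty
  · rw [hempty, Set.ncard_empty, Nat.cast_zero]
    positivity
  dsimp only at hx hy hz hn hS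
  let N : ℤ := (x - z) ^ 2 - (x - z) * (y - z) + (y - z) ^ 2
  let f : ℤ × ℤ × ℤ → ℤ × ℤ := fun t ↦ (t.1 - t.2.2, t.2.1 - t.2.2)
  have hmaps : ∀ t ∈ A, f t ∈ {p : ℤ × ℤ | p.1 ^ 2 - p.1 * p.2 + p.2 ^ 2 = N} := by
    rintro ⟨a, b, c⟩ ⟨-, -, -, hn', hS'⟩
    dsimp only at hn' hS'
    have hN : 2 * N = 3 * S - n ^ 2 := by
      rw [← hn, ← hS]
      ring
    have h : 2 * ((a - c) ^ 2 - (a - c) * (b - c) + (b - c) ^ 2) = 3 * S - n ^ 2 := by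
      rw [← hn', ← hS']
      ring
    change (a - c) ^ 2 - (a - c) * (b - c) + (b - c) ^ 2 = N
    linarith
  have hinj : Set.InjOn f A := by
    rintro ⟨a, b, c⟩ ⟨-, -, -, h, -⟩ ⟨a', b', c'⟩ ⟨-, -, -, h', -⟩ hf
    simp only [f, Prod.mk.injEq] at hf h h' ⊢
    omega
  have hpow : (1 : ℝ) ≤ 2 ^ (ε * d) := Real.one_le_rpow (by norm_num) (by positivity)
  by_cases hN0 : N = 0
  · have hA1 : A.ncard ≤ 1 := by
      rw [← Set.ncard_singleton ((0, 0) : ℤ × ℤ)]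
      refine Set.ncard_le_ncard_of_injOn f (fun t ht ↦ ?_) hinj
      have h := hmaps t ht
      rw [hN0, Set.mem_ofPred_eq] at h
      have h1 : (f t).1 ^ 2 = 0 := by
        nlinarith [sq_nonneg (2 * (f t).2 - (f t).1), sq_nonneg (f t).1]
      have h2 : (f t).2 ^ 2 = 0 := by
        nlinarith [sq_nonneg (2 * (f t).1 - (f t).2), sq_nonneg (f t).2]
      exact Prod.ext (sq_eq_zero_iff.mp h1) (sq_eq_zero_iff.mp h2)
    calc (A.ncard : ℝ) ≤ 1 * 1 := by exact_mod_cast hA1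
      _ ≤ max 1 (C * 12 ^ (ε / 2)) * 2 ^ (ε * d) := by
        gcongr
        exact le_max_left _ _
  · obtain ⟨hfin, hle⟩ := hcount N hN0
    have hNle : |N| ≤ 12 * 4 ^ d := by
      have h4 : (4 : ℤ) ^ d = (2 ^ d) ^ 2 := by rw [← pow_mul, mul_comm, pow_mul]; norm_num
      have hxz : |x - z| ≤ 2 * 2 ^ d := (abs_sub _ _).trans (by linarith)
      have hyz : |y - z| ≤ 2 * 2 ^ d := (abs_sub _ _).trans (by linarith)
      rw [h4]
      calc |N| ≤ |x - z| ^ 2 + |x - z| * |y - z| + |y - z| ^ 2 := by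
            rw [← abs_mul, ← abs_pow, ← abs_pow]
            exact (abs_add_le _ _).trans (add_le_add_left (abs_sub _ _) _)
        _ ≤ (2 * 2 ^ d) ^ 2 + (2 * 2 ^ d) * (2 * 2 ^ d) + (2 * 2 ^ d) ^ 2 := by gcongr
        _ = 12 * (2 ^ d) ^ 2 := by ring
    have hNle' : (N.natAbs : ℝ) ≤ 12 * 4 ^ d := by
      rw [Nat.cast_natAbs]
      exact_mod_cast hNle
    calc (A.ncard : ℝ) ≤ C * (N.natAbs : ℝ) ^ (ε / 2) :=
          le_trans (by exact_mod_cast Set.ncard_le_ncard_of_injOn f hmaps hinj hfin) hle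
      _ ≤ C * (12 * 4 ^ d) ^ (ε / 2) := by gcongr
      _ = C * 12 ^ (ε / 2) * 2 ^ (ε * d) := by
          rw [Real.mul_rpow (by norm_num) (by positivity), ← Real.rpow_natCast_mul (by norm_num),
            show (4 : ℝ) = 2 ^ (2 : ℝ) by norm_num, ← Real.rpow_mul (by norm_num), ← mul_assoc]
          ring_nf
      _ ≤ max 1 (C * 12 ^ (ε / 2)) * 2 ^ (ε * d) := by
          gcongr
          exact le_max_right _ _
end

section
/- Let χ : ℝ → ℂ be a smooth compactly supported function. Then there exists a constant C > 0 (depending only on χ) with the following property: for all real-valued integrable functions h₀, h₁ ∈ L¹(ℝ) whose Fourier transforms ĥ₀, ĥ₁ lie in L¹(ℝ), define Hⱼ(t) = ∫₀ᵗ hⱼ(s) ds and Jⱼ(t) = χ(t) e^{i Hⱼ(t)} for j = 0, 1. Then for every k ∈ [1, ∞], ‖ ⟨ξ⟩ · (Ĵ₁ − Ĵ₀)(ξ) ‖_{L^k_ξ(ℝ)} ≤ C · ‖ (h₁ − h₀)^∧ ‖_{L¹(ℝ)} · ( 1 + ‖ĥ₀‖_{L¹(ℝ)} + ‖ĥ₁‖_{L¹(ℝ)}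 )². -/
open MeasureTheory Complex
open scoped FourierTransform ENNReal

open scoped SchwartzMap Convolution

/-- The Fourier transform of integrable functions is self-adjoint for the bilinear pairing. -/
lemma integral_fourier_mul_eq_integral_mul_fourier {f g : ℝ → ℂ} (hf : Integrable f)
    (hg : Integrable g) : ∫ x, 𝓕 f x * g x = ∫ x, f x * 𝓕 g x := by
  simpa using! VectorFourier.integral_fourierIntegral_smul_eq_flip (L := innerₗ ℝ)
    Real.continuous_fourierChar continuous_inner hf hg

lemma continuous_fourier_of_integrable {f : ℝ → ℂ} (hf : Integrable f) : Continuous (𝓕 f) :=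
  VectorFourier.fourierIntegral_continuous Real.continuous_fourierChar
    (L := innerₗ ℝ) continuous_inner hf

lemma norm_fourier_le_integral_norm (f : ℝ → ℂ) (x : ℝ) : ‖𝓕 f x‖ ≤ ∫ t, ‖f t‖ :=
  VectorFourier.norm_fourierIntegral_le_integral_norm ..

lemma continuous_fourierInv_of_integrable {f : ℝ → ℂ} (hf : Integrable f) :
    Continuous (𝓕⁻ f) := by
  rw [Real.fourierInv_eq_fourier_comp_neg]
  exact continuous_fourier_of_integrable hf.comp_neg

lemma norm_fourierInv_le_integral_norm (f : ℝ → ℂ) (x : ℝ) : ‖𝓕⁻ f x‖ ≤ ∫ t, ‖f t‖ := by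
  rw [Real.fourierInv_eq_fourier_comp_neg]
  exact (norm_fourier_le_integral_norm _ x).trans_eq
    (integral_neg_eq_self (fun t => ‖f t‖) volume)

lemma integrable_fourierChar_smul {f : ℝ → ℂ} (hf : Integrable f) (x : ℝ) :
    Integrable fun t => 𝐞 (-(t * x)) • f t := by
  simpa [mul_comm] using (Real.fourierIntegral_convergent_iff x).2 hf

lemma fourier_sub_of_integrable {f g : ℝ → ℂ} (hf : Integrable f) (hg : Integrable g) (x : ℝ) :
    𝓕 (fun t => f t - g t) x = 𝓕 f x - 𝓕 g x := by
  simp only [Real.fourier_real_eq, smul_sub]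
  exact integral_sub (integrable_fourierChar_smul hf x) (integrable_fourierChar_smul hg x)

lemma fourier_add_of_integrable {f g : ℝ → ℂ} (hf : Integrable f) (hg : Integrable g) (x : ℝ) :
    𝓕 (fun t => f t + g t) x = 𝓕 f x + 𝓕 g x := by
  simp only [Real.fourier_real_eq, smul_add]
  exact integral_add (integrable_fourierChar_smul hf x) (integrable_fourierChar_smul hg x)

/-- Fourier inversion almost everywhere, without continuity. -/
lemma ae_eq_fourierInv_fourier {f : ℝ → ℂ} (hf : Integrable f) (hf' : Integrable (𝓕 f)) :
    f =ᵐ[volume] 𝓕⁻ (𝓕 f) := by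
  refine ae_eq_of_integral_contDiff_smul_eq hf.locallyIntegrable
    (continuous_fourierInv_of_integrable hf').locallyIntegrable fun φ hφ hφs => ?_
  have hs : HasCompactSupport fun x => (φ x : ℂ) := hφs.comp_left (g := ((↑) : ℝ → ℂ)) rfl
  set Φ : 𝓢(ℝ, ℂ) := hs.toSchwartzMap (Complex.ofRealCLM.contDiff.comp hφ) with hΦ
  have hΦφ : ∀ x, Φ x = φ x := fun x => rfl
  calc ∫ x, φ x • f x = ∫ x, 𝓕 (𝓕⁻ Φ) x * f x := by
        simp [FourierTransform.fourier_fourierInv_eq, hΦφ]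
    _ = ∫ x, (𝓕⁻ Φ) x * 𝓕 f x := by
        rw [← integral_fourier_mul_eq_integral_mul_fourier (𝓕⁻ Φ).integrable hf,
          SchwartzMap.fourier_coe]
    _ = ∫ x, 𝓕 (fun x => Φ (-x)) x * 𝓕 f x := by
        rw [SchwartzMap.fourierInv_coe, Real.fourierInv_eq_fourier_comp_neg]
    _ = ∫ x, Φ (-x) * 𝓕 (𝓕 f) x :=
        integral_fourier_mul_eq_integral_mul_fourier Φ.integrable.comp_neg hf'
    _ = ∫ x, φ x • 𝓕⁻ (𝓕 f) x := by
        rw [← integral_neg_eq_self]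
        simp [Real.fourierInv_eq_fourier_neg, hΦφ]

/-- On `L¹ ∩ L²` the Fourier integral represents the `L²` Fourier transform. -/
lemma fourier_toLp_two_ae_eq {f : ℝ → ℂ} (hf : Integrable f) (hf2 : MemLp f 2) :
    (𝓕 (hf2.toLp f) : Lp ℂ 2 (volume : Measure ℝ)) =ᵐ[volume] 𝓕 f := by
  refine ae_eq_of_integral_contDiff_smul_eq
    ((Lp.memLp _).locallyIntegrable (by norm_num))
    (continuous_fourier_of_integrable hf).locallyIntegrable fun φ hφ hφs => ?_
  have hs : HasCompactSupport fun x => (φ x : ℂ) := hφs.comp_left (g := ((↑) : ℝ → ℂ)) rfl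
  set Φ : 𝓢(ℝ, ℂ) := hs.toSchwartzMap (Complex.ofRealCLM.contDiff.comp hφ) with hΦ
  have hΦφ : ∀ x, Φ x = φ x := fun x => rfl
  have key := congrArg (fun T => T Φ)
    (Lp.fourier_toTemperedDistribution_eq (hf2.toLp f))
  simp only [TemperedDistribution.fourier_apply, Lp.toTemperedDistribution_apply] at key
  calc ∫ x, φ x • (𝓕 (hf2.toLp f) : Lp ℂ 2 (volume : Measure ℝ)) x
      = ∫ x, Φ x • (𝓕 (hf2.toLp f) : Lp ℂ 2 (volume : Measure ℝ)) x := by simp [hΦφ]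
    _ = ∫ x, (𝓕 Φ) x * f x := by
        rw [← key]
        refine integral_congr_ae ?_
        filter_upwards [hf2.coeFn_toLp] with x hx
        rw [hx, smul_eq_mul]
    _ = ∫ x, φ x • 𝓕 f x := by
        rw [SchwartzMap.fourier_coe, integral_fourier_mul_eq_integral_mul_fourier Φ.integrable hf]
        simp [hΦφ]

lemma memLp_two_fourier {f : ℝ → ℂ} (hf : Integrable f) (hf2 : MemLp f 2) : MemLp (𝓕 f) 2 :=
  (memLp_congr_ae (fourier_toLp_two_ae_eq hf hf2)).1 (Lp.memLp _)

/-- Plancherel's theorem for the Fourier integral on `L¹ ∩ L²`. -/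
lemma integral_norm_sq_fourier {f : ℝ → ℂ} (hf : Integrable f) (hf2 : MemLp f 2) :
    ∫ x, ‖𝓕 f x‖ ^ 2 = ∫ x, ‖f x‖ ^ 2 := by
  have h1 := Lp.norm_fourier_eq (hf2.toLp f)
  have h2 : 𝓕 (hf2.toLp f) = (memLp_two_fourier hf hf2).toLp (𝓕 f) :=
    Lp.ext ((fourier_toLp_two_ae_eq hf hf2).trans (MemLp.coeFn_toLp _).symm)
  rw [h2, Lp.norm_toLp, Lp.norm_toLp] at h1
  have h3 := congrArg (fun x => x ^ 2) h1
  have e : ∀ g : ℝ → ℂ, MemLp g 2 → (eLpNorm g 2 volume).toReal ^ 2 = ∫ x, ‖g x‖ ^ 2 := by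
    intro g hg
    rw [hg.eLpNorm_eq_integral_rpow_norm (by norm_num) (by norm_num),
      ENNReal.toReal_ofReal (by positivity), ← Real.rpow_natCast, ← Real.rpow_mul (by positivity)]
    simp
  simpa only [e _ hf2, e _ (memLp_two_fourier hf hf2)] using h3

/-- The Fourier transform of a product is the convolution of the Fourier transforms. -/
lemma fourier_mul_eq_convolution {f g : ℝ → ℂ} (hfc : Continuous f) (hf : Integrable f)
    (hf' : Integrable (𝓕 f)) (hg : Integrable g) :
    𝓕 (fun t => f t * g t) = 𝓕 f ⋆[ContinuousLinearMap.mul ℂ ℂ] 𝓕 g := by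
  ext ξ
  have hinv : f = 𝓕 (fun η => 𝓕 f (-η)) := by
    rw [← Real.fourierInv_eq_fourier_comp_neg, hfc.fourierInv_fourier_eq hf hf']
  have hmod := integrable_fourierChar_smul hg ξ
  have hshift : ∀ η, 𝓕 (fun t => 𝐞 (-(t * ξ)) • g t) η = 𝓕 g (η + ξ) := by
    intro η
    simp only [Real.fourier_real_eq]
    congr 1 with t
    rw [smul_smul, ← AddChar.map_add_eq_mul]
    ring_nf
  calc 𝓕 (fun t => f t * g t) ξ = ∫ t, f t * (𝐞 (-(t * ξ)) • g t) := by
        rw [Real.fourier_real_eq]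
        simp only [mul_smul_comm]
    _ = ∫ η, 𝓕 f (-η) * 𝓕 g (η + ξ) := by
        conv_lhs => rw [hinv]
        rw [integral_fourier_mul_eq_integral_mul_fourier hf'.comp_neg hmod]
        simp only [hshift]
    _ = _ := by
        rw [convolution_def, ← integral_neg_eq_self]
        simp [sub_eq_neg_add, add_comm]

lemma integrable_fourier_mul {f g : ℝ → ℂ} (hfc : Continuous f) (hf : Integrable f)
    (hf' : Integrable (𝓕 f)) (hg : Integrable g) (hg' : Integrable (𝓕 g)) :
    Integrable (𝓕 fun t => f t * g t) ∧
      ∫ ξ, ‖𝓕 (fun t => f t * g t) ξ‖ ≤ (∫ ξ, ‖𝓕 f ξ‖) * ∫ ξ, ‖𝓕 g ξ‖ := by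
  rw [fourier_mul_eq_convolution hfc hf hf' hg]
  have hI := hf'.integrable_convolution (ContinuousLinearMap.mul ℂ ℂ) hg'
  refine ⟨hI, ?_⟩
  have hn := integral_convolution (ContinuousLinearMap.mul ℝ ℝ) hf'.norm hg'.norm
    (μ := volume) (ν := volume)
  simp only [ContinuousLinearMap.mul_apply'] at hn
  rw [← hn]
  refine integral_mono hI.norm
    (hf'.norm.integrable_convolution (ContinuousLinearMap.mul ℝ ℝ) hg'.norm) fun ξ => ?_
  simp only [convolution_def, ContinuousLinearMap.mul_apply']
  exact (norm_integral_le_integral_norm _).trans_eq (by simp only [norm_mul])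

/-- A bounded function in `L¹` lies in every `L^k`, with the larger of the two bounds. -/
lemma eLpNorm_le_of_eLpNorm_one_le_of_bound {f : ℝ → ℂ} {B k : ℝ≥0∞} (hk : 1 ≤ k) (hB : B ≠ ∞)
    (h1 : eLpNorm f 1 volume ≤ B) (hb : ∀ x, ‖f x‖ₑ ≤ B) : eLpNorm f k volume ≤ B := by
  rcases eq_or_ne k ∞ with rfl | hkt
  · rw [eLpNorm_exponent_top]
    exact essSup_le_of_ae_le _ (Filter.Eventually.of_forall hb)
  have hk1 : 1 ≤ k.toReal := by simpa using ENNReal.toReal_mono hkt hk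
  have hk0 : k.toReal ≠ 0 := by linarith
  rw [eLpNorm_one_eq_lintegral_enorm] at h1
  rw [eLpNorm_eq_lintegral_rpow_enorm_toReal (by positivity) hkt, one_div,
    ENNReal.rpow_inv_le_iff (by linarith)]
  have hsplit : ∀ y : ℝ≥0∞, y ^ k.toReal = y ^ (k.toReal - 1) * y := fun y => by
    nth_rewrite 3 [← ENNReal.rpow_one y]
    rw [← ENNReal.rpow_add_of_nonneg _ _ (by linarith) zero_le_one, sub_add_cancel]
  calc ∫⁻ x, ‖f x‖ₑ ^ k.toReal ≤ ∫⁻ x, B ^ (k.toReal - 1) * ‖f x‖ₑ := by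
        refine lintegral_mono fun x => ?_
        rw [hsplit]
        gcongr
        exact hb x
    _ = B ^ (k.toReal - 1) * ∫⁻ x, ‖f x‖ₑ :=
        lintegral_const_mul' _ _ (ENNReal.rpow_ne_top_of_nonneg (by linarith) hB)
    _ ≤ B ^ k.toReal := by
        rw [hsplit B]
        gcongr

lemma integral_le_of_support_subset_Icc {g : ℝ → ℝ} {R b : ℝ} (hR : 0 ≤ R)
    (hs : Function.support g ⊆ Set.Icc (-R) R) (hb : ∀ x, |g x| ≤ b) :
    ∫ x, g x ≤ 2 * R * b := by
  rw [← setIntegral_eq_integral_of_forall_compl_eq_zero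
    (fun x hx => Function.notMem_support.1 fun h => hx (hs h))]
  refine (Real.le_norm_self _).trans ((norm_setIntegral_le_of_norm_le_const (C := b)
    (measure_Icc_lt_top (a := -R) (b := R))
    fun x _ => hb x).trans_eq ?_)
  rw [Real.volume_real_Icc_of_le (by linarith)]
  ring

lemma integrable_fourier_of_contDiff {f : ℝ → ℂ} (hf : ContDiff ℝ 1 f)
    (hs : HasCompactSupport f) {a : ℝ} (ha : 0 < a) :
    Integrable (𝓕 f) ∧
      ∫ ξ, ‖𝓕 f ξ‖ ≤ a * (Real.pi / 2) + ((∫ t, ‖f t‖ ^ 2) + ∫ t, ‖deriv f t‖ ^ 2) / (2 * a) := by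
  have hc := hf.continuous
  have hc' : Continuous (deriv f) := hf.continuous_deriv le_rfl
  have hi := hc.integrable_of_hasCompactSupport hs (μ := volume)
  have hi' := hc'.integrable_of_hasCompactSupport hs.deriv (μ := volume)
  have h2 := hc.memLp_of_hasCompactSupport hs (μ := volume) (p := 2)
  have h2' := hc'.memLp_of_hasCompactSupport hs.deriv (μ := volume) (p := 2)
  have hD : ∀ ξ, ‖𝓕 (deriv f) ξ‖ = 2 * Real.pi * |ξ| * ‖𝓕 f ξ‖ := fun ξ => by
    rw [Real.fourier_deriv hi (hf.differentiable one_ne_zero) hi']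
    simp [abs_of_pos Real.pi_pos]
  have hF2 := (memLp_two_iff_integrable_sq_norm
    (memLp_two_fourier hi h2).1).1 (memLp_two_fourier hi h2)
  have hF2' := (memLp_two_iff_integrable_sq_norm
    (memLp_two_fourier hi' h2').1).1 (memLp_two_fourier hi' h2')
  have hmaj : Integrable fun ξ : ℝ =>
      a / 2 * (1 + ξ ^ 2)⁻¹ + (‖𝓕 f ξ‖ ^ 2 + ‖𝓕 (deriv f) ξ‖ ^ 2) / (2 * a) :=
    (integrable_inv_one_add_sq.const_mul _).add ((hF2.add hF2').div_const _)
  have hle : ∀ ξ : ℝ, ‖𝓕 f ξ‖ ≤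
      a / 2 * (1 + ξ ^ 2)⁻¹ + (‖𝓕 f ξ‖ ^ 2 + ‖𝓕 (deriv f) ξ‖ ^ 2) / (2 * a) := by
    intro ξ
    have hw : 0 < 1 + ξ ^ 2 := by positivity
    have h1 : (1 + ξ ^ 2) * ‖𝓕 f ξ‖ ^ 2 ≤ ‖𝓕 f ξ‖ ^ 2 + ‖𝓕 (deriv f) ξ‖ ^ 2 := by
      rw [hD, mul_pow, mul_pow, sq_abs]
      have : 1 ≤ (2 * Real.pi) ^ 2 := by nlinarith [Real.pi_gt_three]
      nlinarith [mul_nonneg (sq_nonneg ξ) (sq_nonneg ‖𝓕 f ξ‖)]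
    have h3 : ‖𝓕 f ξ‖ ≤ a / 2 * (1 + ξ ^ 2)⁻¹ + (1 + ξ ^ 2) * ‖𝓕 f ξ‖ ^ 2 / (2 * a) := by
      have : a / 2 * (1 + ξ ^ 2)⁻¹ + (1 + ξ ^ 2) * ‖𝓕 f ξ‖ ^ 2 / (2 * a) - ‖𝓕 f ξ‖ =
          (a - (1 + ξ ^ 2) * ‖𝓕 f ξ‖) ^ 2 / (2 * a * (1 + ξ ^ 2)) := by
        field_simp
        ring
      have h4 : 0 ≤ (a - (1 + ξ ^ 2) * ‖𝓕 f ξ‖) ^ 2 / (2 * a * (1 + ξ ^ 2)) := by positivity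
      linarith
    exact h3.trans (by gcongr)
  have hI : Integrable (𝓕 f) :=
    hmaj.mono' (continuous_fourier_of_integrable hi).aestronglyMeasurable
      (Filter.Eventually.of_forall hle)
  refine ⟨hI, (integral_mono hI.norm hmaj hle).trans_eq ?_⟩
  have hsum : Integrable fun ξ => (‖𝓕 f ξ‖ ^ 2 + ‖𝓕 (deriv f) ξ‖ ^ 2) / (2 * a) :=
    (hF2.add hF2').div_const _
  rw [integral_add (integrable_inv_one_add_sq.const_mul _) hsum,
    integral_const_mul, integral_div, integral_univ_inv_one_add_sq, integral_add hF2 hF2',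
    integral_norm_sq_fourier hi h2, integral_norm_sq_fourier hi' h2']
  ring

/-- A `C¹` function supported in `[-R, R]` and bounded by `a` together with its derivative has an
integrable Fourier transform, of `L¹` norm `O(a)`. -/
lemma integral_norm_fourier_le_of_bound {f : ℝ → ℂ} {R a : ℝ} (hR : 0 ≤ R) (hf : ContDiff ℝ 1 f)
    (hs : tsupport f ⊆ Set.Icc (-R) R) (hb : ∀ t, ‖f t‖ ≤ a) (hb' : ∀ t, ‖deriv f t‖ ≤ a) :
    Integrable (𝓕 f) ∧ ∫ ξ, ‖𝓕 f ξ‖ ≤ (Real.pi / 2 + 2 * R) * a := by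
  rcases ((norm_nonneg _).trans (hb 0)).eq_or_lt with rfl | ha
  · have h0 : ∀ ξ, 𝓕 f ξ = 0 := fun ξ => by
      have : f = 0 := funext fun t => norm_le_zero_iff.1 (hb t)
      simp [this, Real.fourier_real_eq]
    exact ⟨by simp [funext h0], by simp [h0]⟩
  have hcs : HasCompactSupport f := isCompact_Icc.of_isClosed_subset (isClosed_tsupport f) hs
  obtain ⟨hI, hle⟩ := integrable_fourier_of_contDiff hf hcs ha
  refine ⟨hI, hle.trans ?_⟩
  have key : ∀ g : ℝ → ℂ, Function.support g ⊆ tsupport f → (∀ t, ‖g t‖ ≤ a) →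
      ∫ t, ‖g t‖ ^ 2 ≤ 2 * R * a ^ 2 := fun g hg hga =>
    integral_le_of_support_subset_Icc hR
      (fun t ht => hs (hg fun h => ht (by simp [h]))) fun t => by
        rw [abs_of_nonneg (by positivity)]
        gcongr
        exact hga t
  have h1 := key f (subset_tsupport f) hb
  have h2 := key (deriv f) support_deriv_subset hb'
  calc _ ≤ a * (Real.pi / 2) + (2 * R * a ^ 2 + 2 * R * a ^ 2) / (2 * a) := by gcongr
    _ = _ := by field_simp; ring

section Phase

variable {h H h₀ h₁ H₀ H₁ : ℝ → ℝ} {ψ : ℝ → ℂ} {A R M d : ℝ}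

lemma norm_cexp_I_mul_sub_le (x y : ℝ) : ‖cexp (I * x) - cexp (I * y)‖ ≤ |x - y| := by
  have : cexp (I * x) - cexp (I * y) = cexp (I * y) * (cexp (I * (x - y : ℝ)) - 1) := by
    rw [mul_sub, ← Complex.exp_add, mul_one]
    push_cast
    ring_nf
  rw [this, norm_mul, Complex.norm_exp_I_mul_ofReal, one_mul]
  exact Real.norm_exp_I_mul_ofReal_sub_one_le

lemma hasDerivAt_cexp_I_mul (hH : ∀ t, HasDerivAt H (h t) t) (t : ℝ) :
    HasDerivAt (fun t => cexp (I * H t)) (cexp (I * H t) * (I * h t)) t :=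
  ((hH t).ofReal_comp.const_mul I).cexp

lemma contDiff_cexp_I_mul (hh : Continuous h) (hH : ∀ t, HasDerivAt H (h t) t) :
    ContDiff ℝ 1 fun t => cexp (I * H t) := by
  refine contDiff_one_iff_deriv.2 ⟨fun t => (hasDerivAt_cexp_I_mul hH t).differentiableAt, ?_⟩
  rw [funext fun t => (hasDerivAt_cexp_I_mul hH t).deriv]
  have : Continuous H := continuous_iff_continuousAt.2 fun t => (hH t).continuousAt
  fun_prop

lemma integral_norm_fourier_mul_cexp_le (hR : 0 ≤ R) (hM : 0 ≤ M) (hψ : ContDiff ℝ 1 ψ)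
    (hs : tsupport ψ ⊆ Set.Icc (-R) R) (hb : ∀ t, ‖ψ t‖ ≤ A) (hb' : ∀ t, ‖deriv ψ t‖ ≤ A)
    (hh : Continuous h) (hH : ∀ t, HasDerivAt H (h t) t) (hhM : ∀ t, |h t| ≤ M) :
    Integrable (𝓕 fun t => ψ t * cexp (I * H t)) ∧
      ∫ ξ, ‖𝓕 (fun t => ψ t * cexp (I * H t)) ξ‖ ≤
        (Real.pi / 2 + 2 * R) * (A * (1 + M)) := by
  have hA : 0 ≤ A := (norm_nonneg _).trans (hb 0)
  refine integral_norm_fourier_le_of_bound hR (hψ.mul (contDiff_cexp_I_mul hh hH))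
    ((tsupport_mul_subset_left).trans hs) (fun t => ?_) fun t => ?_
  · rw [norm_mul, Complex.norm_exp_I_mul_ofReal]
    nlinarith [hb t, mul_nonneg hA hM]
  · rw [((hψ.differentiable one_ne_zero t).hasDerivAt.fun_mul (hasDerivAt_cexp_I_mul hH t)).deriv]
    calc _ ≤ ‖deriv ψ t‖ + ‖ψ t‖ * |h t| := by
          refine (norm_add_le _ _).trans_eq ?_
          simp [Complex.norm_exp_I_mul_ofReal]
      _ ≤ A + A * M := by gcongr; exacts [hb' t, hb t, hhM t]
      _ = _ := by ring

lemma abs_antideriv_sub_le (hH₀ : ∀ t, HasDerivAt H₀ (h₀ t) t)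
    (hH₁ : ∀ t, HasDerivAt H₁ (h₁ t) t) (h0 : H₁ 0 = H₀ 0) (hd : ∀ t, |h₁ t - h₀ t| ≤ d) (t : ℝ) :
    |H₁ t - H₀ t| ≤ d * |t| := by
  have := convex_univ.norm_image_sub_le_of_norm_hasDerivWithin_le (x := 0) (y := t)
    (fun s _ => ((hH₁ s).sub (hH₀ s)).hasDerivWithinAt) (fun s _ => hd s)
    (Set.mem_univ _) (Set.mem_univ _)
  simpa [h0] using this

lemma norm_mul_cexp_sub_le (hR : 0 ≤ R) (hd0 : 0 ≤ d) (hs : tsupport ψ ⊆ Set.Icc (-R) R)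
    (hb : ∀ t, ‖ψ t‖ ≤ A) (hH₀ : ∀ t, HasDerivAt H₀ (h₀ t) t)
    (hH₁ : ∀ t, HasDerivAt H₁ (h₁ t) t) (h0 : H₁ 0 = H₀ 0) (hd : ∀ t, |h₁ t - h₀ t| ≤ d) (t : ℝ) :
    ‖ψ t * (cexp (I * H₁ t) - cexp (I * H₀ t))‖ ≤ A * (d * R) := by
  have hA : 0 ≤ A := (norm_nonneg _).trans (hb 0)
  by_cases ht : t ∈ tsupport ψ
  · rw [norm_mul]
    have : |t| ≤ R := abs_le.2 (hs ht)
    have h1 := (norm_cexp_I_mul_sub_le (H₁ t) (H₀ t)).trans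
      (abs_antideriv_sub_le hH₀ hH₁ h0 hd t)
    gcongr
    · exact hb t
    · exact h1.trans (by gcongr)
  · rw [image_eq_zero_of_notMem_tsupport ht]
    simp
    positivity

lemma hasDerivAt_mul_cexp_sub (hψ : ContDiff ℝ 1 ψ) (hH₀ : ∀ t, HasDerivAt H₀ (h₀ t) t)
    (hH₁ : ∀ t, HasDerivAt H₁ (h₁ t) t) (t : ℝ) :
    HasDerivAt (fun t => ψ t * (cexp (I * H₁ t) - cexp (I * H₀ t)))
      (deriv ψ t * (cexp (I * H₁ t) - cexp (I * H₀ t)) +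
        I * (((h₁ t - h₀ t : ℝ) : ℂ) * (ψ t * cexp (I * H₁ t)) +
          (h₀ t : ℂ) * (ψ t * (cexp (I * H₁ t) - cexp (I * H₀ t))))) t := by
  refine ((hψ.differentiable one_ne_zero t).hasDerivAt.fun_mul ((hasDerivAt_cexp_I_mul hH₁ t).fun_sub
    (hasDerivAt_cexp_I_mul hH₀ t))).congr_deriv ?_
  push_cast
  ring

lemma norm_deriv_mul_cexp_sub_le (hR : 0 ≤ R) (hd0 : 0 ≤ d) (hψ : ContDiff ℝ 1 ψ)
    (hs : tsupport ψ ⊆ Set.Icc (-R) R) (hb : ∀ t, ‖ψ t‖ ≤ A) (hb' : ∀ t, ‖deriv ψ t‖ ≤ A)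
    (hH₀ : ∀ t, HasDerivAt H₀ (h₀ t) t) (hH₁ : ∀ t, HasDerivAt H₁ (h₁ t) t) (h0 : H₁ 0 = H₀ 0)
    (hM : ∀ t, |h₀ t| ≤ M) (hd : ∀ t, |h₁ t - h₀ t| ≤ d) (t : ℝ) :
    ‖deriv (fun t => ψ t * (cexp (I * H₁ t) - cexp (I * H₀ t))) t‖ ≤
      A * (1 + R) * d * (1 + M) := by
  have hA : 0 ≤ A := (norm_nonneg _).trans (hb 0)
  have hM0 : 0 ≤ M := (abs_nonneg _).trans (hM 0)
  rw [(hasDerivAt_mul_cexp_sub hψ hH₀ hH₁ t).deriv]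
  have h1 := norm_mul_cexp_sub_le hR hd0
    ((closure_mono support_deriv_subset).trans
      ((isClosed_tsupport ψ).closure_eq.subset.trans hs)) hb' hH₀ hH₁ h0 hd t
  have h2 := norm_mul_cexp_sub_le hR hd0 hs hb hH₀ hH₁ h0 hd t
  calc _ ≤ ‖deriv ψ t * (cexp (I * H₁ t) - cexp (I * H₀ t))‖ + (|h₁ t - h₀ t| * ‖ψ t‖ +
          |h₀ t| * ‖ψ t * (cexp (I * H₁ t) - cexp (I * H₀ t))‖) := by
        refine (norm_add_le _ _).trans (add_le_add le_rfl ?_)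
        rw [norm_mul, norm_I, one_mul]
        refine (norm_add_le _ _).trans_eq ?_
        rw [norm_mul, norm_mul (ψ t) (cexp (I * H₁ t)), Complex.norm_exp_I_mul_ofReal, mul_one,
          norm_mul (h₀ t : ℂ), Complex.norm_real, Complex.norm_real, Real.norm_eq_abs,
          Real.norm_eq_abs]
    _ ≤ A * (d * R) + (d * A + M * (A * (d * R))) := by
        gcongr
        exacts [hd t, hb t, hM t]
    _ ≤ _ := by
        have : 0 ≤ A * d * M := by positivity
        linarith

lemma integral_norm_fourier_mul_cexp_sub_le (hR : 0 ≤ R) (hd0 : 0 ≤ d) (hψ : ContDiff ℝ 1 ψ)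
    (hs : tsupport ψ ⊆ Set.Icc (-R) R) (hb : ∀ t, ‖ψ t‖ ≤ A) (hb' : ∀ t, ‖deriv ψ t‖ ≤ A)
    (hh₀ : Continuous h₀) (hh₁ : Continuous h₁)
    (hH₀ : ∀ t, HasDerivAt H₀ (h₀ t) t) (hH₁ : ∀ t, HasDerivAt H₁ (h₁ t) t) (h0 : H₁ 0 = H₀ 0)
    (hM : ∀ t, |h₀ t| ≤ M) (hd : ∀ t, |h₁ t - h₀ t| ≤ d) :
    Integrable (𝓕 fun t => ψ t * (cexp (I * H₁ t) - cexp (I * H₀ t))) ∧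
      ∫ ξ, ‖𝓕 (fun t => ψ t * (cexp (I * H₁ t) - cexp (I * H₀ t))) ξ‖ ≤
        (Real.pi / 2 + 2 * R) * (A * (1 + R) * d * (1 + M)) := by
  have hA : 0 ≤ A := (norm_nonneg _).trans (hb 0)
  have hM0 : 0 ≤ M := (abs_nonneg _).trans (hM 0)
  refine integral_norm_fourier_le_of_bound hR
    (hψ.mul ((contDiff_cexp_I_mul hh₁ hH₁).sub (contDiff_cexp_I_mul hh₀ hH₀)))
    ((tsupport_mul_subset_left).trans hs) (fun t => ?_)
    (norm_deriv_mul_cexp_sub_le hR hd0 hψ hs hb hb' hH₀ hH₁ h0 hM hd)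
  refine (norm_mul_cexp_sub_le hR hd0 hs hb hH₀ hH₁ h0 hd t).trans ?_
  have h1 : 0 ≤ A * d := by positivity
  have h2 : 0 ≤ A * d * M := by positivity
  have h3 : 0 ≤ A * d * M * R := by positivity
  linarith

end Phase

lemma jb_le_one_add (ξ : ℝ) : jb ξ ≤ 1 + 2 * Real.pi * |ξ| := by
  refine Real.sqrt_le_iff.2 ⟨by positivity, ?_⟩
  have h1 : |ξ| ≤ 2 * Real.pi * |ξ| := by nlinarith [Real.pi_gt_three, abs_nonneg ξ]
  nlinarith [sq_abs ξ, abs_nonneg ξ]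

/-- Bounds on a `C¹` compactly supported function and its derivative, in physical and Fourier
space, control every weighted `L^k` norm of its Fourier transform. -/
lemma eLpNorm_jb_mul_fourier_le {f : ℝ → ℂ} {B : ℝ} {p : ℝ≥0∞} (hp : 1 ≤ p)
    (hf : ContDiff ℝ 1 f) (hs : HasCompactSupport f) (hI : Integrable (𝓕 f))
    (hI' : Integrable (𝓕 (deriv f)))
    (h1 : (∫ ξ, ‖𝓕 f ξ‖) + ∫ ξ, ‖𝓕 (deriv f) ξ‖ ≤ B)
    (h2 : (∫ t, ‖f t‖) + ∫ t, ‖deriv f t‖ ≤ B) :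
    eLpNorm (fun ξ => (jb ξ : ℂ) * 𝓕 f ξ) p volume ≤ ENNReal.ofReal B := by
  have hi := hf.continuous.integrable_of_hasCompactSupport hs (μ := volume)
  have hi' := (hf.continuous_deriv le_rfl).integrable_of_hasCompactSupport hs.deriv (μ := volume)
  have hpt : ∀ ξ, ‖(jb ξ : ℂ) * 𝓕 f ξ‖ ≤ ‖𝓕 f ξ‖ + ‖𝓕 (deriv f) ξ‖ := fun ξ => by
    have hD : ‖𝓕 (deriv f) ξ‖ = 2 * Real.pi * |ξ| * ‖𝓕 f ξ‖ := by
      rw [Real.fourier_deriv hi (hf.differentiable one_ne_zero) hi']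
      simp [abs_of_pos Real.pi_pos]
    rw [hD, norm_mul, Complex.norm_real, Real.norm_of_nonneg (show 0 ≤ jb ξ from Real.sqrt_nonneg _)]
    nlinarith [mul_le_mul_of_nonneg_right (jb_le_one_add ξ) (norm_nonneg (𝓕 f ξ))]
  refine eLpNorm_le_of_eLpNorm_one_le_of_bound hp ENNReal.ofReal_ne_top ?_ fun ξ => ?_
  · rw [eLpNorm_one_eq_lintegral_enorm]
    calc _ ≤ ∫⁻ ξ, ENNReal.ofReal (‖𝓕 f ξ‖ + ‖𝓕 (deriv f) ξ‖) := lintegral_mono fun ξ => by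
          rw [← ofReal_norm]
          exact ENNReal.ofReal_le_ofReal (hpt ξ)
      _ = ENNReal.ofReal (∫ ξ, (‖𝓕 f ξ‖ + ‖𝓕 (deriv f) ξ‖)) :=
          (ofReal_integral_eq_lintegral_ofReal (hI.norm.add hI'.norm)
            (Filter.Eventually.of_forall fun ξ => add_nonneg (norm_nonneg _) (norm_nonneg _))).symm
      _ ≤ _ := ENNReal.ofReal_le_ofReal ((integral_add hI.norm hI'.norm).trans_le h1)
  · rw [← ofReal_norm]
    exact ENNReal.ofReal_le_ofReal ((hpt ξ).trans ((add_le_add (norm_fourier_le_integral_norm _ ξ)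
      (norm_fourier_le_integral_norm _ ξ)).trans h2))

lemma abs_le_integral_norm_fourier {h : ℝ → ℝ} (hc : Continuous h) (hi : Integrable h)
    (hF : Integrable (𝓕 fun t => (h t : ℂ))) (t : ℝ) :
    |h t| ≤ ∫ ξ, ‖𝓕 (fun t => (h t : ℂ)) ξ‖ := by
  have := norm_fourierInv_le_integral_norm (𝓕 fun t => (h t : ℂ)) t
  have hinv : 𝓕⁻ (𝓕 fun t => (h t : ℂ)) = fun t => (h t : ℂ) :=
    (Complex.continuous_ofReal.comp hc).fourierInv_fourier_eq hi.ofReal hF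
  rw [hinv] at this
  simpa using this

/-- A real function with integrable Fourier transform has a continuous representative. -/
lemma exists_continuous_ae_eq {h : ℝ → ℝ} (hi : Integrable h)
    (hF : Integrable (𝓕 fun t => (h t : ℂ))) : ∃ g : ℝ → ℝ, Continuous g ∧ h =ᵐ[volume] g := by
  refine ⟨fun t => (𝓕⁻ (𝓕 fun t => (h t : ℂ)) t).re,
    Complex.continuous_re.comp (continuous_fourierInv_of_integrable hF), ?_⟩
  filter_upwards [ae_eq_fourierInv_fourier hi.ofReal hF] with t ht
  exact (congrArg Complex.re ht :)

lemma eLpNorm_jb_mul_fourier_phase_sub_le {χ : ℝ → ℂ} {h₀ h₁ H₀ H₁ : ℝ → ℝ} {A R : ℝ} {p : ℝ≥0∞}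
    (hp : 1 ≤ p) (hR : 0 ≤ R) (hχ : ContDiff ℝ 1 χ) (hχ' : ContDiff ℝ 1 (deriv χ))
    (hs : tsupport χ ⊆ Set.Icc (-R) R) (hb : ∀ t, ‖χ t‖ ≤ A) (hb' : ∀ t, ‖deriv χ t‖ ≤ A)
    (hb'' : ∀ t, ‖deriv (deriv χ) t‖ ≤ A) (hc₀ : Continuous h₀) (hc₁ : Continuous h₁)
    (hi₀ : Integrable h₀) (hi₁ : Integrable h₁) (hF₀ : Integrable (𝓕 fun t => (h₀ t : ℂ)))
    (hF₁ : Integrable (𝓕 fun t => (h₁ t : ℂ))) (hH₀ : ∀ t, HasDerivAt H₀ (h₀ t) t)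
    (hH₁ : ∀ t, HasDerivAt H₁ (h₁ t) t) (h0 : H₁ 0 = H₀ 0) :
    eLpNorm (fun ξ : ℝ => (jb ξ : ℂ) *
        𝓕 (fun t => χ t * (cexp (I * H₁ t) - cexp (I * H₀ t))) ξ) p volume ≤
      ENNReal.ofReal (3 * (Real.pi / 2 + 2 * R) * (A * (1 + R)) *
        (∫ ξ : ℝ, ‖(𝓕 fun t => ((h₁ t - h₀ t : ℝ) : ℂ)) ξ‖) *
        (1 + (∫ ξ : ℝ, ‖(𝓕 fun t => (h₀ t : ℂ)) ξ‖) +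
          (∫ ξ : ℝ, ‖(𝓕 fun t => (h₁ t : ℂ)) ξ‖)) ^ 2) := by
  have hA : 0 ≤ A := (norm_nonneg _).trans (hb 0)
  have hFd : Integrable (𝓕 fun t => ((h₁ t - h₀ t : ℝ) : ℂ)) := by
    convert hF₁.sub hF₀ using 1
    ext ξ
    push_cast
    exact fourier_sub_of_integrable hi₁.ofReal hi₀.ofReal ξ
  set d := ∫ ξ : ℝ, ‖(𝓕 fun t => ((h₁ t - h₀ t : ℝ) : ℂ)) ξ‖
  set m₀ := ∫ ξ : ℝ, ‖(𝓕 fun t => (h₀ t : ℂ)) ξ‖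
  set m₁ := ∫ ξ : ℝ, ‖(𝓕 fun t => (h₁ t : ℂ)) ξ‖
  have hd0 : 0 ≤ d := integral_nonneg fun _ => norm_nonneg _
  have hm₀ : 0 ≤ m₀ := integral_nonneg fun _ => norm_nonneg _
  have hm₁ : 0 ≤ m₁ := integral_nonneg fun _ => norm_nonneg _
  have hd : ∀ t, |h₁ t - h₀ t| ≤ d := abs_le_integral_norm_fourier (hc₁.sub hc₀) (hi₁.sub hi₀) hFd
  have hM₀ : ∀ t, |h₀ t| ≤ m₀ := abs_le_integral_norm_fourier hc₀ hi₀ hF₀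
  have hM₁ : ∀ t, |h₁ t| ≤ m₁ := abs_le_integral_norm_fourier hc₁ hi₁ hF₁
  have hs' : tsupport (deriv χ) ⊆ Set.Icc (-R) R := (closure_mono support_deriv_subset).trans
    ((isClosed_tsupport χ).closure_eq.subset.trans hs)
  have hcs : HasCompactSupport χ := isCompact_Icc.of_isClosed_subset (isClosed_tsupport χ) hs
  have hE₁ := contDiff_cexp_I_mul hc₁ hH₁
  have hE := hE₁.sub (contDiff_cexp_I_mul hc₀ hH₀)
  have hD : ContDiff ℝ 1 fun t => χ t * (cexp (I * H₁ t) - cexp (I * H₀ t)) := hχ.mul hE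
  have hDs : HasCompactSupport fun t => χ t * (cexp (I * H₁ t) - cexp (I * H₀ t)) :=
    hcs.mul_right
  obtain ⟨hI1, hle1⟩ := integral_norm_fourier_mul_cexp_le hR hm₁ hχ hs hb hb' hc₁ hH₁ hM₁
  obtain ⟨hI2, hle2⟩ := integral_norm_fourier_mul_cexp_sub_le hR hd0 hχ hs hb hb' hc₀ hc₁
    hH₀ hH₁ h0 hM₀ hd
  obtain ⟨hI3, hle3⟩ := integral_norm_fourier_mul_cexp_sub_le hR hd0 hχ' hs' hb' hb'' hc₀ hc₁
    hH₀ hH₁ h0 hM₀ hd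
  have hi1 : Integrable fun t => χ t * cexp (I * H₁ t) :=
    (hχ.mul hE₁).continuous.integrable_of_hasCompactSupport hcs.mul_right
  have hi2 := hD.continuous.integrable_of_hasCompactSupport hDs (μ := volume)
  have hi3 : Integrable fun t => deriv χ t * (cexp (I * H₁ t) - cexp (I * H₀ t)) :=
    (hχ'.mul hE).continuous.integrable_of_hasCompactSupport hcs.deriv.mul_right
  obtain ⟨hIa, hlea⟩ := integrable_fourier_mul (f := fun t => ((h₁ t - h₀ t : ℝ) : ℂ))
    (Complex.continuous_ofReal.comp (hc₁.sub hc₀)) (hi₁.sub hi₀).ofReal hFd hi1 hI1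
  obtain ⟨hIb, hleb⟩ := integrable_fourier_mul (f := fun t => (h₀ t : ℂ))
    (Complex.continuous_ofReal.comp hc₀) hi₀.ofReal hF₀ hi2 hI2
  have hderiv : deriv (fun t => χ t * (cexp (I * H₁ t) - cexp (I * H₀ t))) = fun t =>
      deriv χ t * (cexp (I * H₁ t) - cexp (I * H₀ t)) +
        I * (((h₁ t - h₀ t : ℝ) : ℂ) * (χ t * cexp (I * H₁ t)) +
          (h₀ t : ℂ) * (χ t * (cexp (I * H₁ t) - cexp (I * H₀ t)))) :=
    funext fun t => (hasDerivAt_mul_cexp_sub hχ hH₀ hH₁ t).deriv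
  have hia : Integrable fun t => ((h₁ t - h₀ t : ℝ) : ℂ) * (χ t * cexp (I * H₁ t)) :=
    ((Complex.continuous_ofReal.comp (hc₁.sub hc₀)).mul
      (hχ.mul hE₁).continuous).integrable_of_hasCompactSupport hcs.mul_right.mul_left
  have hib : Integrable fun t => (h₀ t : ℂ) * (χ t * (cexp (I * H₁ t) - cexp (I * H₀ t))) :=
    ((Complex.continuous_ofReal.comp hc₀).mul
      hD.continuous).integrable_of_hasCompactSupport hDs.mul_left
  have hiab : Integrable fun t => ((h₁ t - h₀ t : ℝ) : ℂ) * (χ t * cexp (I * H₁ t)) +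
      (h₀ t : ℂ) * (χ t * (cexp (I * H₁ t) - cexp (I * H₀ t))) := hia.add hib
  have hFD : ∀ ξ, 𝓕 (deriv fun t => χ t * (cexp (I * H₁ t) - cexp (I * H₀ t))) ξ =
      𝓕 (fun t => deriv χ t * (cexp (I * H₁ t) - cexp (I * H₀ t))) ξ +
        I * (𝓕 (fun t => ((h₁ t - h₀ t : ℝ) : ℂ) * (χ t * cexp (I * H₁ t))) ξ +
          𝓕 (fun t => (h₀ t : ℂ) * (χ t * (cexp (I * H₁ t) - cexp (I * H₀ t)))) ξ) := fun ξ => by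
    rw [hderiv, fourier_add_of_integrable hi3 (hiab.const_mul I),
      ← fourier_add_of_integrable hia hib]
    congr 1
    simp only [Real.fourier_real_eq, ← integral_const_mul, mul_smul_comm]
  have hI' : Integrable (𝓕 (deriv fun t => χ t * (cexp (I * H₁ t) - cexp (I * H₀ t)))) := by
    rw [funext hFD]
    exact hI3.add ((hIa.add hIb).const_mul I)
  have hN' : ∫ ξ, ‖𝓕 (deriv fun t => χ t * (cexp (I * H₁ t) - cexp (I * H₀ t))) ξ‖ ≤
      (∫ ξ, ‖𝓕 (fun t => deriv χ t * (cexp (I * H₁ t) - cexp (I * H₀ t))) ξ‖) +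
        ((∫ ξ, ‖𝓕 (fun t => ((h₁ t - h₀ t : ℝ) : ℂ) * (χ t * cexp (I * H₁ t))) ξ‖) +
          ∫ ξ, ‖𝓕 (fun t => (h₀ t : ℂ) * (χ t * (cexp (I * H₁ t) - cexp (I * H₀ t)))) ξ‖) := by
    have hIab : Integrable fun ξ =>
        ‖𝓕 (fun t => ((h₁ t - h₀ t : ℝ) : ℂ) * (χ t * cexp (I * H₁ t))) ξ‖ +
          ‖𝓕 (fun t => (h₀ t : ℂ) * (χ t * (cexp (I * H₁ t) - cexp (I * H₀ t)))) ξ‖ :=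
      hIa.norm.add hIb.norm
    rw [← integral_add hIa.norm hIb.norm, ← integral_add hI3.norm hIab]
    refine integral_mono hI'.norm (hI3.norm.add hIab) fun ξ => ?_
    simp only [hFD]
    refine (norm_add_le _ _).trans (add_le_add le_rfl ?_)
    rw [norm_mul, norm_I, one_mul]
    exact norm_add_le _ _
  have hπ := Real.pi_pos
  set c := Real.pi / 2 + 2 * R with hc_def
  set K := A * (1 + R) with hK_def
  have hc0 : 0 ≤ c := by positivity
  have hK0 : 0 ≤ K := by positivity
  have hAK : A ≤ K := by rw [hK_def]; nlinarith
  have hARK : A * R ≤ K := by rw [hK_def]; nlinarith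
  have hL : 0 ≤ c * K * d := by positivity
  refine eLpNorm_jb_mul_fourier_le hp hD hDs hI2 hI' ?_ ?_
  · have ha : d * (∫ ξ, ‖𝓕 (fun t => χ t * cexp (I * H₁ t)) ξ‖) ≤ c * K * d * (1 + m₁) :=
      calc _ ≤ d * (c * (K * (1 + m₁))) := by gcongr; exact hle1.trans (by gcongr)
        _ = _ := by ring
    have hb : m₀ * (∫ ξ, ‖𝓕 (fun t => χ t * (cexp (I * H₁ t) - cexp (I * H₀ t))) ξ‖) ≤
        c * K * d * (m₀ * (1 + m₀)) :=
      calc _ ≤ m₀ * (c * (K * d * (1 + m₀))) := by gcongr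
        _ = _ := by ring
    calc _ ≤ c * K * d * (1 + m₀) + (c * K * d * (1 + m₀) + (c * K * d * (1 + m₁) +
          c * K * d * (m₀ * (1 + m₀)))) := by linarith
      _ = c * K * d * (3 + 3 * m₀ + m₁ + m₀ ^ 2) := by ring
      _ ≤ c * K * d * (3 * (1 + m₀ + m₁) ^ 2) := by
          gcongr
          nlinarith [mul_nonneg hm₀ hm₁]
      _ = _ := by ring
  · have hsD : tsupport (fun t => χ t * (cexp (I * H₁ t) - cexp (I * H₀ t))) ⊆ Set.Icc (-R) R :=
      tsupport_mul_subset_left.trans hs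
    have e1 := integral_le_of_support_subset_Icc
      (g := fun t => ‖χ t * (cexp (I * H₁ t) - cexp (I * H₀ t))‖) hR
      (fun t ht => hsD (subset_tsupport _ fun h => ht (by simp only [h, norm_zero]))) fun t => by
        rw [abs_norm]
        exact norm_mul_cexp_sub_le hR hd0 hs hb hH₀ hH₁ h0 hd t
    have e2 := integral_le_of_support_subset_Icc
      (g := fun t => ‖deriv (fun t => χ t * (cexp (I * H₁ t) - cexp (I * H₀ t))) t‖) hR
      (fun t ht => hsD (support_deriv_subset fun h => ht (by simp only [h, norm_zero])))
      fun t => by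
        rw [abs_norm]
        exact norm_deriv_mul_cexp_sub_le hR hd0 hχ hs hb hb' hH₀ hH₁ h0 hM₀ hd t
    calc _ ≤ 2 * R * (A * R * d) + 2 * R * (K * d * (1 + m₀)) := by linarith
      _ ≤ c * (K * d) + c * (K * d * (1 + m₀)) := by
          gcongr <;> rw [hc_def] <;> linarith
      _ = c * K * d * (2 + m₀) := by ring
      _ ≤ c * K * d * (3 * (1 + m₀ + m₁) ^ 2) := by
          gcongr
          nlinarith [mul_nonneg hm₀ hm₁]
      _ = _ := by ring

/-- Control of the difference of two cut-off complex exponentials of antiderivatives, in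
weighted Lebesgue norms of Fourier transforms: for `Jⱼ(t) = χ(t) e^{iHⱼ(t)}` with
`Hⱼ(t) = ∫₀ᵗ hⱼ`, one has
`‖⟨ξ⟩ (Ĵ₁ − Ĵ₀)(ξ)‖_{L^k} ≤ C ‖(h₁−h₀)^∧‖_{L¹} (1 + ‖ĥ₀‖_{L¹} + ‖ĥ₁‖_{L¹})²`. -/
theorem gauge_phase_difference_bound (χ : ℝ → ℂ) (hχ : ContDiff ℝ (⊤ : ℕ∞) χ)
    (hχsupp : HasCompactSupport χ) :
    ∃ C : ℝ, 0 < C ∧ ∀ h₀ h₁ : ℝ → ℝ,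
      Integrable h₀ → Integrable h₁ →
      Integrable (𝓕 fun t => (h₀ t : ℂ)) → Integrable (𝓕 fun t => (h₁ t : ℂ)) →
      ∀ k : ℝ≥0∞, 1 ≤ k →
        eLpNorm (fun ξ : ℝ => (jb ξ : ℂ) *
            ((𝓕 fun t => χ t * Complex.exp (Complex.I *
                ((∫ s in (0 : ℝ)..t, h₁ s : ℝ) : ℂ))) ξ -
             (𝓕 fun t => χ t * Complex.exp (Complex.I *
                ((∫ s in (0 : ℝ)..t, h₀ s : ℝ) : ℂ))) ξ)) k volume
          ≤ ENNReal.ofReal (C * (∫ ξ : ℝ, ‖(𝓕 fun t => ((h₁ t - h₀ t : ℝ) : ℂ)) ξ‖) *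
              (1 + (∫ ξ : ℝ, ‖(𝓕 fun t => (h₀ t : ℂ)) ξ‖) +
                (∫ ξ : ℝ, ‖(𝓕 fun t => (h₁ t : ℂ)) ξ‖)) ^ 2) := by
  obtain ⟨R₀, hR₀⟩ := hχsupp.isCompact.isBounded.subset_closedBall 0
  have hs : tsupport χ ⊆ Set.Icc (-max R₀ 0) (max R₀ 0) := fun t ht => by
    have := hR₀ ht
    rw [mem_closedBall_zero_iff, Real.norm_eq_abs] at this
    exact abs_le.1 (this.trans (le_max_left _ _))
  have hχ' : ContDiff ℝ (⊤ : ℕ∞) (deriv χ) := (contDiff_infty_iff_deriv.1 hχ).2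
  obtain ⟨A₀, hA₀⟩ := hχsupp.exists_bound_of_continuous hχ.continuous
  obtain ⟨A₁, hA₁⟩ := hχsupp.deriv.exists_bound_of_continuous hχ'.continuous
  obtain ⟨A₂, hA₂⟩ := hχsupp.deriv.deriv.exists_bound_of_continuous
    (hχ'.continuous_deriv (by simp))
  set R := max R₀ 0
  have hR : 0 ≤ R := le_max_right _ _
  set A := max 1 (max A₀ (max A₁ A₂)) with hA_def
  have hA : 0 < A := zero_lt_one.trans_le (le_max_left _ _)
  refine ⟨3 * (Real.pi / 2 + 2 * R) * (A * (1 + R)), by positivity, ?_⟩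
  intro h₀ h₁ hi₀ hi₁ hF₀ hF₁ k hk
  obtain ⟨g₀, hc₀, hg₀⟩ := exists_continuous_ae_eq hi₀ hF₀
  obtain ⟨g₁, hc₁, hg₁⟩ := exists_continuous_ae_eq hi₁ hF₁
  have hFg₀ : (𝓕 fun t => (h₀ t : ℂ)) = 𝓕 fun t => (g₀ t : ℂ) :=
    funext <| Real.fourier_congr_ae (hg₀.fun_comp Complex.ofReal)
  have hFg₁ : (𝓕 fun t => (h₁ t : ℂ)) = 𝓕 fun t => (g₁ t : ℂ) :=
    funext <| Real.fourier_congr_ae (hg₁.fun_comp Complex.ofReal)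
  have hFgd : (𝓕 fun t => ((h₁ t - h₀ t : ℝ) : ℂ)) = 𝓕 fun t => ((g₁ t - g₀ t : ℝ) : ℂ) :=
    funext <| Real.fourier_congr_ae ((hg₁.sub hg₀).fun_comp Complex.ofReal)
  have hint : ∀ {h g : ℝ → ℝ}, h =ᵐ[volume] g → ∀ t : ℝ, ∫ s in (0 : ℝ)..t, h s =
      ∫ s in (0 : ℝ)..t, g s := fun hhg t =>
    intervalIntegral.integral_congr_ae (hhg.mono fun _ hx _ => hx)
  simp only [hint hg₀, hint hg₁, hFgd]
  rw [hFg₀] at hF₀ ⊢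
  rw [hFg₁] at hF₁ ⊢
  have hH : ∀ {g : ℝ → ℝ}, Continuous g → ∀ t : ℝ,
      HasDerivAt (fun t => ∫ s in (0 : ℝ)..t, g s) (g t) t := fun hg t =>
    (hg.integral_hasStrictDerivAt 0 t).hasDerivAt
  have hdiff : ∀ ξ : ℝ,
      (𝓕 fun t => χ t * cexp (I * ((∫ s in (0 : ℝ)..t, g₁ s : ℝ) : ℂ))) ξ -
        (𝓕 fun t => χ t * cexp (I * ((∫ s in (0 : ℝ)..t, g₀ s : ℝ) : ℂ))) ξ =
      𝓕 (fun t => χ t * (cexp (I * ((∫ s in (0 : ℝ)..t, g₁ s : ℝ) : ℂ)) -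
        cexp (I * ((∫ s in (0 : ℝ)..t, g₀ s : ℝ) : ℂ)))) ξ := fun ξ => by
    have hi : ∀ {g : ℝ → ℝ}, Continuous g →
        Integrable fun t => χ t * cexp (I * ((∫ s in (0 : ℝ)..t, g s : ℝ) : ℂ)) := fun hg =>
      (hχ.continuous.mul (contDiff_cexp_I_mul hg (hH hg)).continuous
        ).integrable_of_hasCompactSupport hχsupp.mul_right
    simp only [mul_sub]
    exact (fourier_sub_of_integrable (hi hc₁) (hi hc₀) ξ).symm
  simp only [hdiff]
  exact eLpNorm_jb_mul_fourier_phase_sub_le hk hR (hχ.of_le (by norm_cast))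
    (hχ'.of_le (by norm_cast)) hs
    (fun t => (hA₀ t).trans (by simp [hA_def])) (fun t => (hA₁ t).trans (by simp [hA_def]))
    (fun t => (hA₂ t).trans (by simp [hA_def])) hc₀ hc₁ (hi₀.congr hg₀) (hi₁.congr hg₁)
    hF₀ hF₁ (hH hc₀) (hH hc₁) (by simp)
end

section
/- For all integers k ≥ r ≥ 1, Σ_{(m₁,…,m_r) ∈ ℤ^r, each m_j ≥ 1, m₁+⋯+m_r = k} ∏_{j=1}^r (m_j !) ≤ 6^k · (k − r)!. -/
open Finset

/-- A composition of `k` into `r` positive parts is a weak composition of `k - r` into `r` parts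
with `1` added to each part. -/
lemma sum_pred_eq_sub {k r : ℕ} {m : Fin r → ℕ} (hsum : ∑ j, m j = k) (hpos : ∀ j, 1 ≤ m j) :
    ∑ j, (m j - 1) = k - r := by
  rw [sum_tsub_distrib _ fun j _ => hpos j, hsum]
  simp

lemma card_compositions_le (k r : ℕ) (hrk : r ≤ k) :
    #{m ∈ Finset.Nat.antidiagonalTuple r k | ∀ j, 1 ≤ m j} ≤ 2 ^ k := by
  calc #{m ∈ Finset.Nat.antidiagonalTuple r k | ∀ j, 1 ≤ m j}
      ≤ #(Finset.Nat.antidiagonalTuple r (k - r)) := by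
        refine card_le_card_of_injOn (fun m j => m j - 1) ?_ ?_
        · intro m hm
          simp only [coe_filter, Set.mem_ofPred_eq, Finset.Nat.mem_antidiagonalTuple] at hm
          simpa [Finset.Nat.mem_antidiagonalTuple] using sum_pred_eq_sub hm.1 hm.2
        · intro m hm n hn h
          simp only [coe_filter, Set.mem_ofPred_eq] at hm hn
          funext j
          have := congrFun h j
          have := hm.2 j
          have := hn.2 j
          grind
    _ = r.multichoose (k - r) := by
        rw [← piAntidiag_univ_fin_eq_antidiagonalTuple, ← map_sym_eq_piAntidiag, card_map, sym_univ,
          card_univ, Sym.card_sym_eq_multichoose, Fintype.card_fin]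
    _ ≤ 2 ^ (r + (k - r) - 1) := by
        rw [Nat.multichoose_eq]
        exact Nat.choose_le_two_pow _ _
    _ ≤ 2 ^ k := Nat.pow_le_pow_right two_pos (by omega)

lemma factorial_le_three_pow_mul (m : ℕ) (hm : 1 ≤ m) :
    m.factorial ≤ 3 ^ m * (m - 1).factorial := by
  rw [← Nat.mul_factorial_pred (by omega)]
  exact Nat.mul_le_mul_right _ (Nat.lt_pow_self (by norm_num)).le

lemma prod_factorial_le {k r : ℕ} {m : Fin r → ℕ} (hsum : ∑ j, m j = k)
    (hpos : ∀ j, 1 ≤ m j) : ∏ j, (m j).factorial ≤ 3 ^ k * (k - r).factorial := by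
  calc ∏ j, (m j).factorial ≤ ∏ j, 3 ^ m j * (m j - 1).factorial :=
        prod_le_prod' fun j _ => factorial_le_three_pow_mul _ (hpos j)
    _ = 3 ^ k * ∏ j, (m j - 1).factorial := by
        rw [prod_mul_distrib, prod_pow_eq_pow_sum, hsum]
    _ ≤ 3 ^ k * (k - r).factorial := by
        rw [← sum_pred_eq_sub hsum hpos]
        exact Nat.mul_le_mul_left _
          (Nat.le_of_dvd (Nat.factorial_pos _) (Nat.prod_factorial_dvd_factorial_sum _ _))

/-- The sum of `∏ mⱼ!` over all compositions of `k` into exactly `r` positive parts is at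
most `6^k (k−r)!`. -/
theorem sum_factorial_compositions_le (k r : ℕ) (hr : 1 ≤ r) (hrk : r ≤ k) :
    ∑ m ∈ (Finset.Nat.antidiagonalTuple r k).filter (fun m => ∀ j, 1 ≤ m j),
        ∏ j, (m j).factorial
      ≤ 6 ^ k * (k - r).factorial := by
  calc _ ≤ #{m ∈ Finset.Nat.antidiagonalTuple r k | ∀ j, 1 ≤ m j}
          • (3 ^ k * (k - r).factorial) := by
        refine sum_le_card_nsmul _ _ _ fun m hm => ?_
        rw [mem_filter, Finset.Nat.mem_antidiagonalTuple] at hm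
        exact prod_factorial_le hm.1 hm.2
    _ ≤ 2 ^ k * (3 ^ k * (k - r).factorial) :=
        Nat.mul_le_mul_right _ (card_compositions_le k r hrk)
    _ = 6 ^ k * (k - r).factorial := by
        rw [← mul_assoc, ← mul_pow]
        norm_num
end

section
/- For all integers N ≥ 1 and k ≥ 1, the quantity S_{N,k} = Σ_{(m₁,…,m_N) ∈ ℕ^N, m₁+⋯+m_N = k} ∏_{j=1}^N (m_j !) satisfies S_{N,k} ≤ 216^k · k! + (12N)^k / k! (an inequality of real numbers). -/
open Finset

theorem factorial_succ_le_pow {k i : ℕ} (h : i + 1 ≤ k) : (i + 1).factorial ≤ k ^ i := by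
  induction i with
  | zero => simp
  | succ i ih =>
    rw [Nat.factorial_succ, pow_succ']
    exact Nat.mul_le_mul h (ih (by omega))

/-- The truncation at `k` of the generating series of the factorials is at most `exp (2 * x)`
on `[0, 1 / (2 * k)]`. -/
theorem sum_factorial_mul_pow_le_exp {k : ℕ} {x : ℝ} (hx : 0 ≤ x) (hkx : 2 * k * x ≤ 1) :
    ∑ m ∈ range (k + 1), (m.factorial : ℝ) * x ^ m ≤ Real.exp (2 * x) := by
  have hterm : ∀ i ∈ range k,
      ((i + 1).factorial : ℝ) * x ^ (i + 1) ≤ x * (1 / 2) ^ i := by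
    intro i hi
    have hfac : ((i + 1).factorial : ℝ) ≤ (k : ℝ) ^ i := by
      exact_mod_cast factorial_succ_le_pow (Finset.mem_range.mp hi)
    calc ((i + 1).factorial : ℝ) * x ^ (i + 1) ≤ (k : ℝ) ^ i * x ^ (i + 1) := by gcongr
      _ = x * (k * x) ^ i := by ring
      _ ≤ x * (1 / 2) ^ i := by
        gcongr
        linarith
  have hgeom : ∑ i ∈ range k, (1 / 2 : ℝ) ^ i ≤ 2 := sum_geometric_two_le k
  calc ∑ m ∈ range (k + 1), (m.factorial : ℝ) * x ^ m
      = ∑ i ∈ range k, ((i + 1).factorial : ℝ) * x ^ (i + 1) + 1 := by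
        rw [Finset.sum_range_succ']; simp
    _ ≤ ∑ i ∈ range k, x * (1 / 2) ^ i + 1 := by grw [Finset.sum_le_sum hterm]
    _ = x * ∑ i ∈ range k, (1 / 2 : ℝ) ^ i + 1 := by rw [Finset.mul_sum]
    _ ≤ 2 * x + 1 := by nlinarith
    _ ≤ Real.exp (2 * x) := Real.add_one_le_exp _

theorem sum_prod_antidiagonalTuple_mul_pow_le (N k : ℕ) {a : ℕ → ℕ} {x : ℝ} (hx : 0 ≤ x) :
    ((∑ m ∈ Finset.Nat.antidiagonalTuple N k, ∏ j, a (m j) : ℕ) : ℝ) * x ^ k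
      ≤ (∑ m ∈ range (k + 1), (a m : ℝ) * x ^ m) ^ N := by
  calc ((∑ m ∈ Finset.Nat.antidiagonalTuple N k, ∏ j, a (m j) : ℕ) : ℝ) * x ^ k
      = ∑ m ∈ Finset.Nat.antidiagonalTuple N k, ∏ j, ((a (m j) : ℝ) * x ^ m j) := by
        push_cast
        rw [Finset.sum_mul]
        refine Finset.sum_congr rfl fun m hm => ?_
        rw [Finset.prod_mul_distrib, Finset.prod_pow_eq_pow_sum,
          Finset.Nat.mem_antidiagonalTuple.mp hm]
    _ ≤ ∑ m ∈ Fintype.piFinset fun _ : Fin N => range (k + 1),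
          ∏ j, ((a (m j) : ℝ) * x ^ m j) := by
        refine Finset.sum_le_sum_of_subset_of_nonneg (fun m hm => ?_)
          fun m _ _ => Finset.prod_nonneg fun j _ => by positivity
        rw [Fintype.mem_piFinset]
        intro j
        rw [Finset.mem_range, Nat.lt_succ_iff, ← Finset.Nat.mem_antidiagonalTuple.mp hm]
        exact Finset.single_le_sum (f := m) (fun _ _ => Nat.zero_le _) (Finset.mem_univ j)
    _ = (∑ m ∈ range (k + 1), (a m : ℝ) * x ^ m) ^ N := by
        rw [← Finset.prod_univ_sum (fun _ : Fin N => range (k + 1)) fun _ m => (a m : ℝ) * x ^ m]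
        simp

theorem sum_factorial_antidiagonalTuple_le (N k : ℕ) {x : ℝ} (hx : 0 < x)
    (hkx : 2 * k * x ≤ 1) (hNx : 2 * N * x ≤ k) :
    ((∑ m ∈ Finset.Nat.antidiagonalTuple N k, ∏ j, (m j).factorial : ℕ) : ℝ)
      ≤ (3 / x) ^ k := by
  rw [div_pow, le_div_iff₀ (by positivity)]
  calc _ ≤ (∑ m ∈ range (k + 1), (m.factorial : ℝ) * x ^ m) ^ N :=
        sum_prod_antidiagonalTuple_mul_pow_le N k hx.le
    _ ≤ Real.exp (2 * x) ^ N := by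
        gcongr
        exact sum_factorial_mul_pow_le_exp hx.le hkx
    _ = Real.exp (2 * N * x) := by rw [← Real.exp_nat_mul]; ring_nf
    _ ≤ Real.exp k := Real.exp_le_exp.mpr hNx
    _ = Real.exp 1 ^ k := by rw [← Real.exp_nat_mul, mul_one]
    _ ≤ 3 ^ k := by
        gcongr
        exact Real.exp_one_lt_three.le

/-- The key combinatorial estimate in the proof of the sub-Gaussian tail bound for sums of
fourth powers of Gaussians: the sum `S_{N,k}` of `∏ mⱼ!` over all `N`-tuples of nonnegative
integers summing to `k` satisfies `S_{N,k} ≤ 216^k k! + (12N)^k / k!`. -/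
theorem sum_factorial_weak_compositions_le (N k : ℕ) (hN : 1 ≤ N) (hk : 1 ≤ k) :
    ((∑ m ∈ Finset.Nat.antidiagonalTuple N k, ∏ j, (m j).factorial : ℕ) : ℝ)
      ≤ 216 ^ k * (k.factorial : ℝ) + (12 * (N : ℝ)) ^ k / (k.factorial : ℝ) := by
  have hN' : (0 : ℝ) < N := by exact_mod_cast hN
  have hk' : (0 : ℝ) < k := by exact_mod_cast hk
  rcases le_total (N : ℝ) ((k : ℝ) ^ 2) with h | h
  · have hpow : (k : ℝ) ^ k ≤ 3 ^ k * k.factorial := by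
      have hexp := Real.pow_div_factorial_le_exp (k : ℝ) hk'.le k
      rw [div_le_iff₀ (by positivity), ← mul_one (k : ℝ), Real.exp_nat_mul, mul_one] at hexp
      refine hexp.trans ?_
      gcongr
      exact Real.exp_one_lt_three.le
    refine le_add_of_le_of_nonneg ?_ (by positivity)
    calc _ ≤ (3 / (1 / (2 * k) : ℝ)) ^ k := by
          refine sum_factorial_antidiagonalTuple_le N k (by positivity) ?_ ?_
          · exact (mul_one_div_cancel (by positivity)).le
          · rw [mul_one_div, div_le_iff₀ (by positivity)]
            nlinarith
      _ = 6 ^ k * (k : ℝ) ^ k := by rw [← mul_pow]; congr 1; field_simp; norm_num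
      _ ≤ 6 ^ k * (3 ^ k * k.factorial) := by gcongr
      _ = 18 ^ k * k.factorial := by rw [← mul_assoc, ← mul_pow]; norm_num
      _ ≤ 216 ^ k * k.factorial := by gcongr; norm_num
  · refine le_add_of_nonneg_of_le (by positivity) ?_
    calc _ ≤ (3 / (k / (2 * N) : ℝ)) ^ k := by
          refine sum_factorial_antidiagonalTuple_le N k (by positivity) ?_ ?_
          · rw [← mul_div_assoc, div_le_one (by positivity)]
            nlinarith
          · exact (mul_div_cancel₀ _ (by positivity)).le
      _ = (6 * N) ^ k / (k : ℝ) ^ k := by rw [← div_pow]; congr 1; field_simp; norm_num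
      _ ≤ (12 * N) ^ k / (k.factorial : ℝ) := by
          gcongr
          · norm_num
          · exact_mod_cast Nat.factorial_le_pow k
end

section
/- For every integer μ ≥ 0 and every real number θ, define C¹ = −((μ+1)/2) · Σ_{i=1}^{μ+2} θ^{2i}; C² = −(μ+1)·θ² + Σ_{i=2}^{μ+2} θ^{2i}; C³ = (1/2) · ( (μ+1)·θ² + Σ_{i=2}^{μ+2} (2i − μ − 5)·θ^{2i} ); C⁴ = ((μ+1)(μ+2)/2)·θ²; and C⁵ = −(μ(μ+1)/2)·θ² + Σ_{i=2}^{μ+1} (μ + 2 − i)·θ^{2i}. Then C¹ + C² + C³ + C⁴ + C⁵ = 0. -/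
open Finset

/-- The five resonant coefficients arising from the gauge-transformed truncated
Benjamin–Ono equation add up to zero ("miraculous cancellation"). -/
theorem resonant_cancellation (μ : ℕ) (θ : ℝ) :
    (-(((μ : ℝ) + 1) / 2) * ∑ i ∈ Finset.Icc 1 (μ + 2), θ ^ (2 * i))
    + (-((μ : ℝ) + 1) * θ ^ 2 + ∑ i ∈ Finset.Icc 2 (μ + 2), θ ^ (2 * i))
    + ((1 / 2 : ℝ) * (((μ : ℝ) + 1) * θ ^ 2
        + ∑ i ∈ Finset.Icc 2 (μ + 2), (2 * (i : ℝ) - (μ : ℝ) - 5) * θ ^ (2 * i)))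
    + (((μ : ℝ) + 1) * ((μ : ℝ) + 2) / 2 * θ ^ 2)
    + (-((μ : ℝ) * ((μ : ℝ) + 1) / 2) * θ ^ 2
        + ∑ i ∈ Finset.Icc 2 (μ + 1), ((μ : ℝ) + 2 - (i : ℝ)) * θ ^ (2 * i)) = 0 := by
  have h₁ : ∑ i ∈ Finset.Icc 1 (μ + 2), θ ^ (2 * i)
      = θ ^ 2 + ∑ i ∈ Finset.Icc 2 (μ + 2), θ ^ (2 * i) := by
    rw [← Finset.add_sum_Ioc_eq_sum_Icc (by lia), ← Finset.Icc_add_one_left_eq_Ioc]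
    norm_num
  have h₂ : ∑ i ∈ Finset.Icc 2 (μ + 1), ((μ : ℝ) + 2 - (i : ℝ)) * θ ^ (2 * i)
      = ∑ i ∈ Finset.Icc 2 (μ + 2), ((μ : ℝ) + 2 - (i : ℝ)) * θ ^ (2 * i) := by
    rw [Finset.sum_Icc_succ_top (by lia : 2 ≤ μ + 1 + 1)]
    push_cast
    ring
  have h₃ : ∑ i ∈ Finset.Icc 2 (μ + 2), (2 * (i : ℝ) - (μ : ℝ) - 5) * θ ^ (2 * i)
      = (μ - 1) * ∑ i ∈ Finset.Icc 2 (μ + 2), θ ^ (2 * i)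
        - 2 * ∑ i ∈ Finset.Icc 2 (μ + 2), ((μ : ℝ) + 2 - (i : ℝ)) * θ ^ (2 * i) := by
    rw [Finset.mul_sum, Finset.mul_sum, ← Finset.sum_sub_distrib]
    exact Finset.sum_congr rfl fun i _ => by ring
  rw [h₁, h₂, h₃]
  ring
end

section
/- For every integer μ ≥ 0 and every real number θ, Σ_{(μ₁,μ₂,μ₃) ∈ ℕ³, μ₁+μ₂+μ₃ = μ} ( θ^{2μ₃+4} − θ^{2μ₂+4} + θ² − θ^{2μ₃+2} ) = (μ(μ+1)/2)·θ² − Σ_{i=2}^{μ+1} (μ + 2 − i)·θ^{2i}. -/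
open Finset

theorem sum_antidiagonalTuple_succ {M : Type*} [AddCommMonoid M] (k n : ℕ)
    (f : (Fin (k + 1) → ℕ) → M) :
    ∑ m ∈ Finset.Nat.antidiagonalTuple (k + 1) n, f m
      = ∑ p ∈ antidiagonal n, ∑ m ∈ Finset.Nat.antidiagonalTuple k p.2, f (Fin.cons p.1 m) := by
  rw [Finset.sum_sigma']
  refine Finset.sum_bij' (fun m _ => ⟨(m 0, ∑ i, Fin.tail m i), Fin.tail m⟩)
    (fun x _ => Fin.cons x.1.1 x.2) ?_ ?_ ?_ ?_ ?_
  · intro m hm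
    simpa [Finset.Nat.mem_antidiagonalTuple, Fin.sum_univ_succ, Fin.tail] using hm
  · rintro ⟨⟨a, b⟩, m⟩ hx
    simp only [mem_sigma, HasAntidiagonal.mem_antidiagonal, Finset.Nat.mem_antidiagonalTuple] at hx
    simp [Finset.Nat.mem_antidiagonalTuple, Fin.sum_univ_succ, hx.1, hx.2]
  · simp
  · rintro ⟨⟨a, b⟩, m⟩ hx
    simp only [mem_sigma, HasAntidiagonal.mem_antidiagonal, Finset.Nat.mem_antidiagonalTuple] at hx
    simp [hx.2]
  · simp

theorem sum_antidiagonalTuple_comp_perm {M : Type*} [AddCommMonoid M] {k : ℕ} (n : ℕ)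
    (e : Equiv.Perm (Fin k)) (f : (Fin k → ℕ) → M) :
    ∑ m ∈ Finset.Nat.antidiagonalTuple k n, f (m ∘ e)
      = ∑ m ∈ Finset.Nat.antidiagonalTuple k n, f m := by
  refine Finset.sum_equiv (e.symm.arrowCongr (Equiv.refl ℕ)) (fun m => ?_) (fun m _ => ?_)
  · simp [Finset.Nat.mem_antidiagonalTuple, Equiv.arrowCongr, Equiv.sum_comp e m]
  · rfl

/-- There are `n + 1 - j` ordered triples of natural numbers with sum `n` whose `i`-th entry
is `j`. -/
theorem sum_antidiagonalTuple_three_apply (n : ℕ) (i : Fin 3) (f : ℕ → ℝ) :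
    ∑ m ∈ Finset.Nat.antidiagonalTuple 3 n, f (m i)
      = ∑ j ∈ range (n + 1), ((n : ℝ) + 1 - j) * f j := by
  have h := sum_antidiagonalTuple_comp_perm n (Equiv.swap 0 i) (fun m => f (m 0))
  simp only [Function.comp_apply, Equiv.swap_apply_left] at h
  rw [h, sum_antidiagonalTuple_succ]
  simp only [Fin.cons_zero, sum_const, nsmul_eq_mul, Finset.Nat.antidiagonalTuple_two, card_map,
    Finset.Nat.card_antidiagonal]
  rw [Finset.Nat.sum_antidiagonal_eq_sum_range_succ_mk]
  refine Finset.sum_congr rfl fun j hj => ?_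
  have hj : j ≤ n := Nat.lt_succ_iff.mp (mem_range.mp hj)
  push_cast [Nat.cast_sub hj]
  ring

theorem sum_range_succ_add_one_sub (n : ℕ) :
    ∑ j ∈ range (n + 1), ((n : ℝ) + 1 - j) = ((n : ℝ) + 1) * (n + 2) / 2 := by
  induction n with
  | zero => simp
  | succ n ih =>
    rw [Finset.sum_range_succ']
    simp only [Nat.cast_add, Nat.cast_one, add_sub_add_right_eq_sub, ih, Nat.cast_zero]
    ring

/-- Evaluation of the resonant coefficient `C⁵` coming from the term `K⁵` in the
gauge-transformed truncated Benjamin–Ono equation: the sum over ordered triples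
`(μ₁, μ₂, μ₃)` of nonnegative integers with `μ₁ + μ₂ + μ₃ = μ` of
`θ^(2μ₃+4) − θ^(2μ₂+4) + θ² − θ^(2μ₃+2)` equals
`μ(μ+1)/2 · θ² − ∑_{i=2}^{μ+1} (μ+2−i) θ^(2i)`. -/
theorem resonant_coefficient_C5 (μ : ℕ) (θ : ℝ) :
    ∑ m ∈ Finset.Nat.antidiagonalTuple 3 μ,
        (θ ^ (2 * m 2 + 4) - θ ^ (2 * m 1 + 4) + θ ^ 2 - θ ^ (2 * m 2 + 2))
      = (μ : ℝ) * ((μ : ℝ) + 1) / 2 * θ ^ 2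
        - ∑ i ∈ Finset.Icc 2 (μ + 1), ((μ : ℝ) + 2 - (i : ℝ)) * θ ^ (2 * i) := by
  have hsplit : ∑ i ∈ Finset.Icc 2 (μ + 1), ((μ : ℝ) + 2 - (i : ℝ)) * θ ^ (2 * i)
      = ∑ j ∈ range (μ + 1), ((μ : ℝ) + 1 - j) * θ ^ (2 * j + 2) - ((μ : ℝ) + 1) * θ ^ 2 := by
    rw [← Finset.Ico_add_one_right_eq_Icc, Finset.sum_Ico_eq_sum_range, Finset.sum_range_succ']
    simp only [Nat.cast_zero, mul_zero, zero_add, sub_zero, add_sub_cancel_right]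
    refine Finset.sum_congr (by congr 1) fun j _ => ?_
    push_cast
    ring
  simp only [sum_sub_distrib, sum_add_distrib]
  rw [sum_antidiagonalTuple_three_apply μ 2 fun j => θ ^ (2 * j + 4),
    sum_antidiagonalTuple_three_apply μ 1 fun j => θ ^ (2 * j + 4),
    sum_antidiagonalTuple_three_apply μ 2 fun j => θ ^ (2 * j + 2),
    sum_antidiagonalTuple_three_apply μ 2 fun _ => θ ^ 2,
    ← sum_mul, sum_range_succ_add_one_sub, hsplit]
  ring
end

section
/- For every ε > 0 there exists a constant C > 0 with the following property. Let d ≥ 1 be an integer and let K₁, K₂ ∈ ℤ satisfy |K₁| + |K₂| ≤ 2^{d/40}, and let n₀ ∈ ℤ. Then the number of triples (n₁, n₂, n₃) ∈ ℤ³ such that |n_l| ≤ 2^{d+1} for l = 1, 2, 3, n₀ + n₁ + n₂ + n₃ = K₁, |n₀|n₀ + |n₁|n₁ + |n₂|n₂ + |n₃|n₃ = K₂, and no two of the four numbers n₀, n₁, n₂, n₃ sum to zero, is at most C · 2^{εd}. -/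
/-- The signed square `|n|·n`, the dispersion symbol of the Benjamin–Ono equation. -/
def signedSq (n : ℤ) : ℤ := |n| * n

open Finset in
/-- The divisor bound: `d(n) ≪_δ n ^ δ`. -/
theorem exists_card_divisors_le_rpow (δ : ℝ) (hδ : 0 < δ) :
    ∃ C : ℝ, 1 ≤ C ∧ ∀ n : ℕ, 0 < n → (#n.divisors : ℝ) ≤ C * (n : ℝ) ^ δ := by
  obtain ⟨P, hP⟩ := exists_nat_ge ((2 : ℝ) ^ (1 / δ))
  set L : ℝ := 1 + 1 / (δ * Real.log 2) with hL
  have hlog : 0 < Real.log 2 := Real.log_pos one_lt_two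
  have hL1 : 1 ≤ L := by
    have : 0 < 1 / (δ * Real.log 2) := by positivity
    linarith
  refine ⟨L ^ P, one_le_pow₀ hL1, fun n hn => ?_⟩
  have hlocal : ∀ p ∈ n.primeFactors, ((n.factorization p + 1 : ℕ) : ℝ) ≤
      (if p < P then L else 1) * ((p : ℝ) ^ n.factorization p) ^ δ := by
    intro p hp
    have hp2 : (2 : ℝ) ≤ p := by exact_mod_cast (Nat.prime_of_mem_primeFactors hp).two_le
    generalize n.factorization p = a
    have hpow : ((p : ℝ) ^ a) ^ δ = ((p : ℝ) ^ δ) ^ a := by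
      rw [← Real.rpow_natCast, ← Real.rpow_natCast, ← Real.rpow_mul (by positivity),
        ← Real.rpow_mul (by positivity), mul_comm]
    rw [hpow]
    split_ifs with h
    · have h1 : 1 + δ * Real.log 2 * a ≤ ((p : ℝ) ^ δ) ^ a := by
        calc 1 + δ * Real.log 2 * a ≤ Real.exp (δ * Real.log 2 * a) := by
              linarith [Real.add_one_le_exp (δ * Real.log 2 * a)]
          _ = ((2 : ℝ) ^ δ) ^ a := by
              rw [Real.rpow_def_of_pos two_pos, ← Real.exp_nat_mul]; ring_nf
          _ ≤ _ := by gcongr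
      have h2 : ((a + 1 : ℕ) : ℝ) ≤ L * (1 + δ * Real.log 2 * a) := by
        have : L * (1 + δ * Real.log 2 * a) =
            1 + 1 / (δ * Real.log 2) + δ * Real.log 2 * a + a := by
          rw [hL]; field_simp; ring
        rw [this]; push_cast
        have : 0 ≤ 1 / (δ * Real.log 2) := by positivity
        have : 0 ≤ δ * Real.log 2 * a := by positivity
        linarith
      exact h2.trans (by gcongr)
    · have h1 : (2 : ℝ) ≤ (p : ℝ) ^ δ := by
        have h3 : (2 : ℝ) ^ (1 / δ) ≤ p := hP.trans (by exact_mod_cast not_lt.mp h)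
        calc (2 : ℝ) = ((2 : ℝ) ^ (1 / δ)) ^ δ := by
              rw [← Real.rpow_mul two_pos.le, one_div_mul_cancel hδ.ne', Real.rpow_one]
          _ ≤ _ := by gcongr
      rw [one_mul]
      calc ((a + 1 : ℕ) : ℝ) ≤ (2 : ℝ) ^ a := by exact_mod_cast Nat.lt_two_pow_self
        _ ≤ _ := by gcongr
  have hn_prod : (n : ℝ) ^ δ = ∏ p ∈ n.primeFactors, ((p : ℝ) ^ n.factorization p) ^ δ := by
    rw [Real.finsetProd_rpow _ _ (fun p _ => by positivity)]
    congr 1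
    conv_lhs => rw [← Nat.prod_factorization_pow_eq_self hn.ne']
    rw [Finsupp.prod, Nat.support_factorization]
    push_cast
    rfl
  have hsmall : ∏ p ∈ n.primeFactors, (if p < P then L else 1) ≤ L ^ P := by
    rw [prod_ite, prod_const, prod_const_one, mul_one]
    refine pow_le_pow_right₀ hL1 ?_
    calc #{p ∈ n.primeFactors | p < P} ≤ #(range P) :=
          card_le_card fun p hp => mem_range.2 (mem_filter.1 hp).2
      _ = P := card_range P
  rw [Nat.card_divisors hn.ne']
  push_cast at hlocal ⊢
  calc _ ≤ ∏ p ∈ n.primeFactors,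
        ((if p < P then L else 1) * ((p : ℝ) ^ n.factorization p) ^ δ) :=
        prod_le_prod (fun p _ => by positivity) hlocal
    _ ≤ _ := by
        rw [prod_mul_distrib, ← hn_prod]
        gcongr

open Finset in
/-- The congruence `t² + t + 1 ≡ 0 (mod N)` has at most `3 d(N)` solutions. -/
theorem card_roots_cyclotomic_three_le (N : ℕ) (hN : 0 < N) :
    #({t ∈ range N | (N : ℤ) ∣ ((t : ℕ) : ℤ) ^ 2 + t + 1} : Finset ℕ) ≤ 3 * #N.divisors := by
  rcases Finset.eq_empty_or_nonempty
      ({t ∈ range N | (N : ℤ) ∣ ((t : ℕ) : ℤ) ^ 2 + t + 1} : Finset ℕ) with h | ⟨r, hr⟩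
  · simp [h]
  have hr' := (mem_filter.1 hr).2
  rw [mul_comm, ← card_range 3, ← card_product]
  refine card_le_card_of_injOn (fun t => (Int.gcd ((t : ℤ) - r) N, 3 * t / N)) ?_ ?_
  · intro t ht
    have ht' := mem_range.1 (mem_filter.1 (mem_coe.1 ht)).1
    simp only [coe_product, Set.mem_prod, mem_coe, Nat.mem_divisors, mem_range]
    refine ⟨⟨?_, hN.ne'⟩, ?_⟩
    · exact_mod_cast Int.gcd_dvd_right ((t : ℤ) - r) N
    · rw [Nat.div_lt_iff_lt_mul hN]; omega
  · intro t ht s hs hts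
    have ht' := (mem_filter.1 (mem_coe.1 ht)).2
    have hs' := (mem_filter.1 (mem_coe.1 hs)).2
    obtain ⟨hg, hq⟩ := Prod.mk.inj hts
    have key : ∀ x : ℤ, (N : ℤ) ∣ x ^ 2 + x + 1 →
        (N : ℤ) ∣ (Int.gcd (x - r) N : ℤ) * (x + r + 1) := by
      intro x hx
      rw [Int.gcd_eq_gcd_ab]
      have h1 : (N : ℤ) ∣ (x ^ 2 + x + 1) - ((r : ℤ) ^ 2 + r + 1) := dvd_sub hx hr'
      have h2 := (h1.mul_right (Int.gcdA (x - r) N)).add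
        ((dvd_refl (N : ℤ)).mul_right (Int.gcdB (x - r) N * (x + r + 1)))
      exact h2.trans (dvd_of_eq (by ring))
    have h1 := key t ht'
    have h2 := key s hs'
    have hct : (Int.gcd ((t : ℤ) - r) N : ℤ) ∣ (t : ℤ) - r := Int.gcd_dvd_left ..
    have hcs : (Int.gcd ((s : ℤ) - r) N : ℤ) ∣ (s : ℤ) - r := Int.gcd_dvd_left ..
    rw [← hg] at h2 hcs
    set c : ℤ := (Int.gcd ((t : ℤ) - r) N : ℤ)
    have hc : c ∣ (t : ℤ) - s := by
      exact (dvd_sub hct hcs).trans (dvd_of_eq (by ring))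
    have h3 : (N : ℤ) ∣ c * ((t : ℤ) - s) := by
      exact (dvd_sub h1 h2).trans (dvd_of_eq (by ring))
    have h4 : (N : ℤ) ∣ ((t : ℤ) - r) * ((t : ℤ) - s) := h3.trans (mul_dvd_mul_right hct _)
    have h5 : (N : ℤ) ∣ ((t : ℤ) - s) * ((t : ℤ) + r + 1) := h1.trans (mul_dvd_mul_right hc _)
    have h6 : (N : ℤ) ∣ 3 * t - 3 * s := by
      exact (dvd_sub (hr'.mul_right (4 * ((t : ℤ) - s)))
        ((dvd_sub h5 h4).mul_right (2 * r + 1))).trans (dvd_of_eq (by ring))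
    have h7 : 3 * s % N = 3 * t % N := by
      apply (Nat.modEq_iff_dvd).2
      exact_mod_cast h6
    have h8 := Nat.div_add_mod (3 * t) N
    have h9 := Nat.div_add_mod (3 * s) N
    rw [hq, ← h7] at h8
    omega

/-- A primitive representation of `N` by `u² + uv + v²` gives a root of `t² + t + 1` mod `N`. -/
theorem exists_root_of_isCoprime {N : ℕ} (hN : 0 < N) {u v : ℤ} (huv : IsCoprime u v)
    (h : u ^ 2 + u * v + v ^ 2 = N) :
    ∃ t : ℕ, t < N ∧ (N : ℤ) ∣ (t : ℤ) ^ 2 + t + 1 ∧ (N : ℤ) ∣ u - t * v := by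
  have hvN : IsCoprime v (N : ℤ) := by
    rw [← h, show u ^ 2 + u * v + v ^ 2 = u ^ 2 + v * (u + v) by ring]
    exact (huv.symm.pow_right (n := 2)).add_mul_left_right _
  obtain ⟨x, y, hxy⟩ := hvN
  have hNz : (0 : ℤ) < N := by exact_mod_cast hN
  obtain ⟨t, ht⟩ := Int.eq_ofNat_of_zero_le (Int.emod_nonneg (x * u) hNz.ne')
  have htlt := Int.emod_lt_of_pos (x * u) hNz
  have hmod : (N : ℤ) ∣ x * u - t := by
    rw [← ht]; exact Int.dvd_self_sub_emod
  have huv' : (N : ℤ) ∣ u - t * v := by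
    obtain ⟨k, hk⟩ := hmod
    exact ⟨u * y + k * v, by linear_combination (-u) * hxy + v * hk⟩
  refine ⟨t, by omega, ?_, huv'⟩
  have hco : IsCoprime (N : ℤ) (v ^ 2) := IsCoprime.pow_right ⟨y, x, by linarith⟩
  refine hco.dvd_of_dvd_mul_left ?_
  obtain ⟨k, hk⟩ := huv'
  exact ⟨1 - k * (u + t * v) - k * v, by linear_combination h - (u + t * v + v) * hk⟩

open Finset in
/-- There are at most `27 d(N)` primitive representations of `N` by `u² + uv + v²`. -/
theorem card_primitive_le (N : ℕ) (hN : 0 < N) (s : Finset (ℤ × ℤ))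
    (hs : ∀ z ∈ s, IsCoprime z.1 z.2 ∧ z.1 ^ 2 + z.1 * z.2 + z.2 ^ 2 = N) :
    #s ≤ 27 * #N.divisors := by
  have hNz : (N : ℤ) ≠ 0 := by exact_mod_cast hN.ne'
  have hex : ∀ z : ℤ × ℤ, ∃ t : ℕ, z ∈ s → t < N ∧ (N : ℤ) ∣ (t : ℤ) ^ 2 + t + 1 ∧
      (N : ℤ) ∣ z.1 - t * z.2 := by
    intro z
    by_cases hz : z ∈ s
    · obtain ⟨t, ht⟩ := exists_root_of_isCoprime hN (hs z hz).1 (hs z hz).2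
      exact ⟨t, fun _ => ht⟩
    · exact ⟨0, fun h => absurd h hz⟩
  choose f hf using hex
  have himage : #(s.image f) ≤ 3 * #N.divisors := by
    refine (card_le_card ?_).trans (card_roots_cyclotomic_three_le N hN)
    intro t ht
    obtain ⟨z, hz, rfl⟩ := mem_image.1 ht
    exact mem_filter.2 ⟨mem_range.2 (hf z hz).1, (hf z hz).2.1⟩
  have hfiber : ∀ t ∈ s.image f, #{z ∈ s | f z = t} ≤ 9 := by
    intro t ht
    obtain ⟨w, hw, rfl⟩ := mem_image.1 ht
    obtain ⟨p, q⟩ := w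
    have hpq := (hs _ hw).2
    obtain ⟨-, hroot, hw'⟩ := hf _ hw
    set t := f (p, q)
    simp only at hpq hw'
    have hdvd : ∀ z ∈ s, f z = t → (N : ℤ) ∣ z.1 * p + z.1 * q + z.2 * q ∧
        (N : ℤ) ∣ z.2 * p - z.1 * q := by
      intro z hz hzt
      obtain ⟨a, ha⟩ := hzt ▸ (hf z hz).2.2
      obtain ⟨b, hb⟩ := hw'
      obtain ⟨r, hr⟩ := hroot
      constructor
      · exact ⟨a * p + t * z.2 * b + a * q + z.2 * q * r, by
          linear_combination (p + q) * ha + t * z.2 * hb + z.2 * q * hr⟩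
      · exact ⟨z.2 * b - a * q, by linear_combination z.2 * hb - q * ha⟩
    have h9 : 9 = #(Icc (-1 : ℤ) 1 ×ˢ Icc (-1 : ℤ) 1) := by decide
    rw [h9]
    refine card_le_card_of_injOn
      (fun z => ((z.1 * p + z.1 * q + z.2 * q) / (N : ℤ), (z.2 * p - z.1 * q) / (N : ℤ))) ?_ ?_
    · intro z hz
      obtain ⟨hzs, hzt⟩ := mem_filter.1 (mem_coe.1 hz)
      obtain ⟨⟨a, ha⟩, ⟨b, hb⟩⟩ := hdvd z hzs hzt
      have hz2 := (hs z hzs).2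
      simp only [coe_product, Set.mem_prod, mem_coe, mem_Icc]
      rw [ha, hb, Int.mul_ediv_cancel_left _ hNz, Int.mul_ediv_cancel_left _ hNz]
      have hab : a ^ 2 + a * b + b ^ 2 = 1 := by
        have : (N : ℤ) ^ 2 * (a ^ 2 + a * b + b ^ 2) = (N : ℤ) ^ 2 * 1 := by
          calc (N : ℤ) ^ 2 * (a ^ 2 + a * b + b ^ 2)
              = (N * a) ^ 2 + (N * a) * (N * b) + (N * b) ^ 2 := by ring
            _ = (z.1 ^ 2 + z.1 * z.2 + z.2 ^ 2) * (p ^ 2 + p * q + q ^ 2) := by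
              rw [← ha, ← hb]; ring
            _ = _ := by rw [hz2, hpq]; ring
        exact mul_left_cancel₀ (pow_ne_zero 2 hNz) this
      refine ⟨⟨?_, ?_⟩, ?_, ?_⟩ <;> nlinarith [sq_nonneg (a + 2 * b), sq_nonneg (2 * a + b)]
    · intro z hz w hw h
      obtain ⟨hzs, hzt⟩ := mem_filter.1 (mem_coe.1 hz)
      obtain ⟨hws, hwt⟩ := mem_filter.1 (mem_coe.1 hw)
      obtain ⟨hA, hB⟩ := Prod.mk.inj h
      have hA' := (Int.ediv_left_inj (hdvd z hzs hzt).1 (hdvd w hws hwt).1).1 hA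
      have hB' := (Int.ediv_left_inj (hdvd z hzs hzt).2 (hdvd w hws hwt).2).1 hB
      refine Prod.ext (mul_left_cancel₀ hNz ?_) (mul_left_cancel₀ hNz ?_)
      · rw [← hpq]; linear_combination p * hA' - q * hB'
      · rw [← hpq]; linear_combination q * hA' + (p + q) * hB'
  calc #s ≤ 9 * #(s.image f) := card_le_mul_card_image s 9 hfiber
    _ ≤ 9 * (3 * #N.divisors) := by gcongr
    _ = _ := by ring

open Finset in
/-- There are at most `27 d(N)²` representations of `N` by `u² + uv + v²`. -/
theorem card_representations_le (N : ℕ) (hN : 0 < N) (s : Finset (ℤ × ℤ))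
    (hs : ∀ z ∈ s, z.1 ^ 2 + z.1 * z.2 + z.2 ^ 2 = N) :
    #s ≤ 27 * #N.divisors ^ 2 := by
  have hNz : (N : ℤ) ≠ 0 := by exact_mod_cast hN.ne'
  have hgcd : ∀ z ∈ s, 0 < Int.gcd z.1 z.2 := by
    intro z hz
    refine Nat.pos_of_ne_zero fun h0 => hNz ?_
    obtain ⟨h1, h2⟩ := Int.gcd_eq_zero_iff.1 h0
    rw [← hs z hz, h1, h2]; ring
  have himage : #(s.image fun z => Int.gcd z.1 z.2) ≤ #N.divisors := by
    refine card_le_card fun g hg => ?_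
    obtain ⟨z, hz, rfl⟩ := mem_image.1 hg
    refine Nat.mem_divisors.2 ⟨?_, hN.ne'⟩
    have h1 : (Int.gcd z.1 z.2 : ℤ) ∣ z.1 := Int.gcd_dvd_left ..
    have h2 : (Int.gcd z.1 z.2 : ℤ) ∣ z.2 := Int.gcd_dvd_right ..
    have h3 : (Int.gcd z.1 z.2 : ℤ) ∣ N := by
      rw [← hs z hz]
      exact ((h1.pow two_ne_zero).add (h1.mul_right _)).add (h2.pow two_ne_zero)
    exact_mod_cast h3
  have hfiber : ∀ g ∈ s.image (fun z => Int.gcd z.1 z.2),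
      #{z ∈ s | Int.gcd z.1 z.2 = g} ≤ 27 * #N.divisors := by
    intro g hg
    obtain ⟨w, hw, hwg⟩ := mem_image.1 hg
    have hg0 : 0 < g := hwg ▸ hgcd w hw
    have hgz : (g : ℤ) ≠ 0 := by exact_mod_cast hg0.ne'
    have hquot : ∀ z ∈ s, Int.gcd z.1 z.2 = g →
        IsCoprime (z.1 / g) (z.2 / g) ∧ z.1 = g * (z.1 / g) ∧ z.2 = g * (z.2 / g) := by
      intro z hz hzg
      have h1 : (g : ℤ) ∣ z.1 := hzg ▸ Int.gcd_dvd_left ..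
      have h2 : (g : ℤ) ∣ z.2 := hzg ▸ Int.gcd_dvd_right ..
      refine ⟨?_, (Int.mul_ediv_cancel' h1).symm, (Int.mul_ediv_cancel' h2).symm⟩
      rw [Int.isCoprime_iff_gcd_eq_one, ← hzg]
      exact Int.gcd_ediv_gcd_ediv_gcd (hgcd z hz)
    have hnorm : ∀ z ∈ s, Int.gcd z.1 z.2 = g →
        (g : ℤ) ^ 2 * ((z.1 / g) ^ 2 + (z.1 / g) * (z.2 / g) + (z.2 / g) ^ 2) = N := by
      intro z hz hzg
      obtain ⟨-, h1, h2⟩ := hquot z hz hzg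
      rw [← hs z hz]
      conv_rhs => rw [h1, h2]
      ring
    have hgN : g ^ 2 ∣ N := by
      have : (g : ℤ) ^ 2 ∣ N := ⟨_, (hnorm w hw hwg).symm⟩
      exact_mod_cast this
    obtain ⟨M, hM⟩ := hgN
    have hM0 : 0 < M := Nat.pos_of_ne_zero fun h => hN.ne' (by rw [hM, h, mul_zero])
    have hinj : Set.InjOn (fun z : ℤ × ℤ => (z.1 / (g : ℤ), z.2 / (g : ℤ)))
        ({z ∈ s | Int.gcd z.1 z.2 = g} : Finset (ℤ × ℤ)) := by
      intro z hz y hy h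
      obtain ⟨hz1, hz2⟩ := mem_filter.1 (mem_coe.1 hz)
      obtain ⟨hy1, hy2⟩ := mem_filter.1 (mem_coe.1 hy)
      obtain ⟨-, h1, h2⟩ := hquot z hz1 hz2
      obtain ⟨-, h3, h4⟩ := hquot y hy1 hy2
      obtain ⟨h5, h6⟩ := Prod.mk.inj h
      exact Prod.ext (by rw [h1, h3, h5]) (by rw [h2, h4, h6])
    rw [← card_image_of_injOn hinj]
    refine (card_primitive_le M hM0 _ ?_).trans ?_
    · intro y hy
      obtain ⟨z, hz, rfl⟩ := mem_image.1 hy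
      obtain ⟨hz1, hz2⟩ := mem_filter.1 hz
      refine ⟨(hquot z hz1 hz2).1, mul_left_cancel₀ (pow_ne_zero 2 hgz) ?_⟩
      rw [hnorm z hz1 hz2, hM]
      push_cast; rfl
    · gcongr
      · exact ⟨g ^ 2, by rw [hM, mul_comm]⟩
  calc #s ≤ 27 * #N.divisors * #(s.image fun z => Int.gcd z.1 z.2) :=
        card_le_mul_card_image s _ hfiber
    _ ≤ 27 * #N.divisors * #N.divisors := by gcongr
    _ = _ := by ring

open Finset in
/-- Counting triples with prescribed sum and prescribed `a² + b² + c²`. -/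
theorem card_definite_le {ι : Type*} (s : Finset ι) (a b c : ι → ℤ) (S T R : ℤ)
    (hR : 1 ≤ R) (hinj : ∀ i ∈ s, ∀ j ∈ s, a i = a j → b i = b j → c i = c j → i = j)
    (hbound : ∀ i ∈ s, |a i| ≤ R ∧ |b i| ≤ R ∧ |c i| ≤ R)
    (hsum : ∀ i ∈ s, a i + b i + c i = S)
    (hsq : ∀ i ∈ s, a i ^ 2 + b i ^ 2 + c i ^ 2 = T) :
    ∃ m : ℕ, 0 < m ∧ (m : ℤ) ≤ 48 * R ^ 2 ∧ #s ≤ 27 * #m.divisors ^ 2 := by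
  rcases s.eq_empty_or_nonempty with rfl | ⟨k, hk⟩
  · exact ⟨1, one_pos, by push_cast; nlinarith, by simp⟩
  let φ : ι → ℤ × ℤ := fun i => (3 * a i - S, 3 * b i - S)
  have hφ : Set.InjOn φ s := by
    intro i hi j hj h
    obtain ⟨h1, h2⟩ := Prod.mk.inj h
    have h3 := hsum i hi
    have h4 := hsum j hj
    exact hinj i hi j hj (by omega) (by omega) (by omega)
  have hrep : ∀ i ∈ s, 2 * ((φ i).1 ^ 2 + (φ i).1 * (φ i).2 + (φ i).2 ^ 2) =
      9 * T - 3 * S ^ 2 := by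
    intro i hi
    rw [← hsq i hi, ← hsum i hi]
    simp only [φ, ← hsum i hi]
    ring
  set n : ℤ := (φ k).1 ^ 2 + (φ k).1 * (φ k).2 + (φ k).2 ^ 2 with hn
  have hn0 : 0 ≤ n := by
    nlinarith [sq_nonneg ((φ k).1 + (φ k).2), sq_nonneg (φ k).1, sq_nonneg (φ k).2]
  have hnR : n ≤ 48 * R ^ 2 := by
    obtain ⟨h1, h2, h3⟩ := hbound k hk
    have h4 := hsum k hk
    rw [abs_le] at h1 h2 h3
    have h5 : abs (φ k).1 ≤ 4 * R := by
      rw [abs_le]; simp only [φ]; constructor <;> linarith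
    have h6 : abs (φ k).2 ≤ 4 * R := by
      rw [abs_le]; simp only [φ]; constructor <;> linarith
    have h7 := sq_le_sq' (abs_le.1 h5).1 (abs_le.1 h5).2
    have h8 := sq_le_sq' (abs_le.1 h6).1 (abs_le.1 h6).2
    nlinarith [sq_nonneg ((φ k).1 - (φ k).2)]
  have hrep' : ∀ z ∈ s.image φ, z.1 ^ 2 + z.1 * z.2 + z.2 ^ 2 = n := by
    intro z hz
    obtain ⟨i, hi, rfl⟩ := mem_image.1 hz
    have h1 := hrep i hi
    have h2 := hrep k hk
    rw [← hn] at h2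
    linarith
  rw [← card_image_of_injOn hφ]
  rcases hn0.eq_or_lt with h0 | hpos
  · refine ⟨1, one_pos, by push_cast; nlinarith, ?_⟩
    have : s.image φ ⊆ {(0, 0)} := by
      intro z hz
      have h1 := hrep' z hz
      rw [← h0] at h1
      have h2 : z.1 = 0 := by
        have : z.1 ^ 2 = 0 := by nlinarith [sq_nonneg (z.1 + 2 * z.2), sq_nonneg z.1]
        simpa using this
      have h3 : z.2 = 0 := by
        have : z.2 ^ 2 = 0 := by nlinarith [sq_nonneg (2 * z.1 + z.2), sq_nonneg z.2]
        simpa using this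
      exact mem_singleton.2 (Prod.ext h2 h3)
    refine (card_le_card this).trans (by simp)
  · obtain ⟨m, hm⟩ := Int.eq_ofNat_of_zero_le hn0
    refine ⟨m, by omega, by omega, ?_⟩
    exact card_representations_le m (by omega) _ fun z hz => (hrep' z hz).trans hm

open Finset in
/-- Counting triples with prescribed sum and prescribed `a² + b² - c²`, away from the
degenerate solutions. -/
theorem card_indefinite_le {ι : Type*} (s : Finset ι) (a b c : ι → ℤ) (S T R : ℤ)
    (hR : 1 ≤ R) (hinj : ∀ i ∈ s, ∀ j ∈ s, a i = a j → b i = b j → c i = c j → i = j)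
    (hbound : ∀ i ∈ s, |a i| ≤ R ∧ |b i| ≤ R ∧ |c i| ≤ R)
    (hsum : ∀ i ∈ s, a i + b i + c i = S)
    (hsq : ∀ i ∈ s, a i ^ 2 + b i ^ 2 - c i ^ 2 = T)
    (hac : ∀ i ∈ s, a i + c i ≠ 0) (hbc : ∀ i ∈ s, b i + c i ≠ 0) :
    ∃ m : ℕ, 0 < m ∧ (m : ℤ) ≤ 48 * R ^ 2 ∧ #s ≤ 27 * #m.divisors ^ 2 := by
  rcases s.eq_empty_or_nonempty with rfl | ⟨k, hk⟩
  · exact ⟨1, one_pos, by push_cast; nlinarith, by simp⟩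
  have hfac : ∀ i ∈ s, 2 * ((a i + c i) * (b i + c i)) = S ^ 2 - T := by
    intro i hi
    rw [← hsum i hi, ← hsq i hi]; ring
  set n : ℤ := (a k + c k) * (b k + c k) with hn
  have hn0 : n ≠ 0 := mul_ne_zero (hac k hk) (hbc k hk)
  have hfac' : ∀ i ∈ s, (a i + c i) * (b i + c i) = n := by
    intro i hi
    have h1 := hfac i hi
    have h2 := hfac k hk
    rw [← hn] at h2
    linarith
  have hnR : |n| ≤ 48 * R ^ 2 := by
    obtain ⟨h1, h2, h3⟩ := hbound k hk
    rw [hn, abs_mul]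
    have h4 : |a k + c k| ≤ 2 * R := (abs_add_le _ _).trans (by linarith)
    have h5 : |b k + c k| ≤ 2 * R := (abs_add_le _ _).trans (by linarith)
    calc |a k + c k| * |b k + c k| ≤ (2 * R) * (2 * R) := by gcongr
      _ ≤ 48 * R ^ 2 := by nlinarith
  refine ⟨n.natAbs, Int.natAbs_pos.2 hn0, by rwa [Int.natCast_natAbs], ?_⟩
  have hcard : #s ≤ #(n.natAbs.divisors ×ˢ (univ : Finset Bool)) := by
    refine card_le_card_of_injOn
      (fun i => ((a i + c i).natAbs, decide (0 ≤ a i + c i))) ?_ ?_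
    · intro i hi
      simp only [coe_product, Set.mem_prod, mem_coe, Nat.mem_divisors, mem_univ, and_true]
      exact ⟨Int.natAbs_dvd_natAbs.2 ⟨_, (hfac' i hi).symm⟩, Int.natAbs_ne_zero.2 hn0⟩
    · intro i hi j hj h
      obtain ⟨h1, h2⟩ := Prod.mk.inj h
      have h3 : a i + c i = a j + c j := by
        rw [decide_eq_decide] at h2
        omega
      have h4 : b i + c i = b j + c j := by
        refine mul_left_cancel₀ (hac i hi) ?_
        rw [hfac' i hi, h3, hfac' j hj]
      have h5 := hsum i hi
      have h6 := hsum j hj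
      exact hinj i hi j hj (by omega) (by omega) (by omega)
  rw [card_product, card_univ, Fintype.card_bool] at hcard
  have : 0 < #n.natAbs.divisors := card_pos.2 (Nat.nonempty_divisors.2 (Int.natAbs_ne_zero.2 hn0))
  nlinarith

theorem signedSq_of_nonneg {n : ℤ} (h : 0 ≤ n) : signedSq n = n ^ 2 := by
  rw [signedSq, abs_of_nonneg h, sq]

theorem signedSq_of_nonpos {n : ℤ} (h : n ≤ 0) : signedSq n = -n ^ 2 := by
  rw [signedSq, abs_of_nonpos h]; ring

/-- Divisor-type counting part of the resonance lemma for the Benjamin–Ono equation: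
for every `ε > 0` there is `C > 0` so that, whenever `d ≥ 1`, `|K₁| + |K₂| ≤ 2^(d/40)`
and `n₀` is fixed, the number of triples `(n₁, n₂, n₃)` with `|nₗ| ≤ 2^(d+1)`,
`n₀ + n₁ + n₂ + n₃ = K₁`, `|n₀|n₀ + |n₁|n₁ + |n₂|n₂ + |n₃|n₃ = K₂`, and no two of
`n₀, n₁, n₂, n₃` summing to zero, is at most `C · 2^(εd)`. -/
theorem resonance_counting (ε : ℝ) (hε : 0 < ε) :
    ∃ C : ℝ, 0 < C ∧ ∀ (d : ℕ) (K₁ K₂ n₀ : ℤ), 1 ≤ d →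
      ((|K₁| : ℝ) + (|K₂| : ℝ) ≤ (2 : ℝ) ^ ((d : ℝ) / 40)) →
      (({t : ℤ × ℤ × ℤ |
          |t.1| ≤ 2 ^ (d + 1) ∧ |t.2.1| ≤ 2 ^ (d + 1) ∧ |t.2.2| ≤ 2 ^ (d + 1) ∧
          n₀ + t.1 + t.2.1 + t.2.2 = K₁ ∧
          signedSq n₀ + signedSq t.1 + signedSq t.2.1 + signedSq t.2.2 = K₂ ∧
          n₀ + t.1 ≠ 0 ∧ n₀ + t.2.1 ≠ 0 ∧ n₀ + t.2.2 ≠ 0 ∧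
          t.1 + t.2.1 ≠ 0 ∧ t.1 + t.2.2 ≠ 0 ∧ t.2.1 + t.2.2 ≠ 0}).ncard : ℝ)
        ≤ C * (2 : ℝ) ^ (ε * d) := by
  obtain ⟨C, hC, hdiv⟩ := exists_card_divisors_le_rpow (ε / 4) (by positivity)
  refine ⟨8 * (27 * (C * 192 ^ (ε / 4)) ^ 2), by positivity, ?_⟩
  intro d K₁ K₂ n₀ _ _
  set A := {t : ℤ × ℤ × ℤ |
          |t.1| ≤ 2 ^ (d + 1) ∧ |t.2.1| ≤ 2 ^ (d + 1) ∧ |t.2.2| ≤ 2 ^ (d + 1) ∧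
          n₀ + t.1 + t.2.1 + t.2.2 = K₁ ∧
          signedSq n₀ + signedSq t.1 + signedSq t.2.1 + signedSq t.2.2 = K₂ ∧
          n₀ + t.1 ≠ 0 ∧ n₀ + t.2.1 ≠ 0 ∧ n₀ + t.2.2 ≠ 0 ∧
          t.1 + t.2.1 ≠ 0 ∧ t.1 + t.2.2 ≠ 0 ∧ t.2.1 + t.2.2 ≠ 0} with hA
  set R : ℤ := 2 ^ (d + 1) with hR
  have hR1 : 1 ≤ R := one_le_pow₀ one_le_two
  have hfin : A.Finite := by
    refine (Finset.finite_toSet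
      (Finset.Icc (-R) R ×ˢ Finset.Icc (-R) R ×ˢ Finset.Icc (-R) R)).subset ?_
    rintro t ⟨h1, h2, h3, -⟩
    simp only [Finset.coe_product, Set.mem_prod, Finset.mem_coe, Finset.mem_Icc]
    exact ⟨abs_le.1 h1, abs_le.1 h2, abs_le.1 h3⟩
  rw [Set.ncard_eq_toFinset_card A hfin]
  set s := hfin.toFinset
  have hs : ∀ t ∈ s, t ∈ A := fun t ht => hfin.mem_toFinset.1 ht
  have hreal : ∀ m : ℕ, 0 < m → (m : ℤ) ≤ 48 * R ^ 2 →
      (27 * (m.divisors.card : ℝ) ^ 2) ≤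
        27 * (C * 192 ^ (ε / 4)) ^ 2 * (2 : ℝ) ^ (ε * d) := by
    intro m hm hmR
    have hmR' : (m : ℝ) ≤ 192 * (2 : ℝ) ^ (2 * d : ℝ) := by
      have h1 : (m : ℝ) ≤ 48 * (2 ^ (d + 1)) ^ 2 := by rw [hR] at hmR; exact_mod_cast hmR
      refine h1.trans_eq ?_
      rw [show (2 * d : ℝ) = ((2 * d : ℕ) : ℝ) by push_cast; ring, Real.rpow_natCast]
      ring
    have h2 : (m.divisors.card : ℝ) ≤ C * 192 ^ (ε / 4) * (2 : ℝ) ^ (ε * d / 2) := by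
      calc (m.divisors.card : ℝ) ≤ C * (m : ℝ) ^ (ε / 4) := hdiv m hm
        _ ≤ C * (192 * (2 : ℝ) ^ (2 * d : ℝ)) ^ (ε / 4) := by gcongr
        _ = _ := by
          rw [Real.mul_rpow (by positivity) (by positivity), ← Real.rpow_mul two_pos.le,
            mul_assoc]
          ring_nf
    have h3 : (2 : ℝ) ^ (ε * d) = ((2 : ℝ) ^ (ε * d / 2)) ^ 2 := by
      rw [← Real.rpow_natCast, ← Real.rpow_mul two_pos.le]
      push_cast; ring_nf
    calc 27 * (m.divisors.card : ℝ) ^ 2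
        ≤ 27 * (C * 192 ^ (ε / 4) * (2 : ℝ) ^ (ε * d / 2)) ^ 2 := by gcongr
      _ = _ := by rw [h3]; ring
  have hcast : ∀ k : ℕ, (∃ m : ℕ, 0 < m ∧ (m : ℤ) ≤ 48 * R ^ 2 ∧
      k ≤ 27 * m.divisors.card ^ 2) →
      (k : ℝ) ≤ 27 * (C * 192 ^ (ε / 4)) ^ 2 * (2 : ℝ) ^ (ε * d) := by
    rintro k ⟨m, hm, hmR, hk⟩
    refine le_trans ?_ (hreal m hm hmR)
    exact_mod_cast hk
  let sgn : ℤ × ℤ × ℤ → Bool × Bool × Bool :=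
    fun t => (decide (0 ≤ t.1), decide (0 ≤ t.2.1), decide (0 ≤ t.2.2))
  have hfiber : ∀ σ : Bool × Bool × Bool, (({t ∈ s | sgn t = σ} : Finset _).card : ℝ) ≤
      27 * (C * 192 ^ (ε / 4)) ^ 2 * (2 : ℝ) ^ (ε * d) := by
    intro σ
    apply hcast
    let x : ℤ × ℤ × ℤ → ℤ := fun t => t.1
    let y : ℤ × ℤ × ℤ → ℤ := fun t => t.2.1
    let z : ℤ × ℤ × ℤ → ℤ := fun t => t.2.2
    have hxyz : ∀ t u : ℤ × ℤ × ℤ, x t = x u → y t = y u → z t = z u → t = u :=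
      fun t u h1 h2 h3 => Prod.ext h1 (Prod.ext h2 h3)
    have hsq : ∀ t ∈ ({t ∈ s | sgn t = σ} : Finset _),
        (if σ.1 then x t ^ 2 else -x t ^ 2) + (if σ.2.1 then y t ^ 2 else -y t ^ 2) +
          (if σ.2.2 then z t ^ 2 else -z t ^ 2) = K₂ - signedSq n₀ := by
      intro t ht
      obtain ⟨hts, rfl⟩ := Finset.mem_filter.1 ht
      have hsgn : ∀ n : ℤ, (if decide (0 ≤ n) then n ^ 2 else -n ^ 2) = signedSq n := by
        intro n
        by_cases h : 0 ≤ n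
        · simp [h, signedSq_of_nonneg]
        · simp [h, signedSq_of_nonpos (not_le.1 h).le]
      obtain ⟨-, -, -, -, h, -⟩ := hs t hts
      simp only [sgn, x, y, z, hsgn]
      linarith
    have hb : ∀ t ∈ ({t ∈ s | sgn t = σ} : Finset _), |x t| ≤ R ∧ |y t| ≤ R ∧ |z t| ≤ R ∧
        x t + y t + z t = K₁ - n₀ ∧ x t + y t ≠ 0 ∧ x t + z t ≠ 0 ∧ y t + z t ≠ 0 := by
      intro t ht
      obtain ⟨h1, h2, h3, h4, -, -, -, -, h5, h6, h7⟩ := hs t (Finset.mem_filter.1 ht).1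
      exact ⟨h1, h2, h3, by simp only [x, y, z]; linarith, h5, h6, h7⟩
    generalize ({t ∈ s | sgn t = σ} : Finset _) = F at hsq hb ⊢
    clear_value x y z
    obtain ⟨_ | _, _ | _, _ | _⟩ := σ <;>
      simp only [Bool.false_eq_true, if_true, if_false] at hsq
    · refine card_definite_le F x y z (K₁ - n₀) (-(K₂ - signedSq n₀)) R hR1 ?_ ?_ ?_ ?_ <;> grind
    · refine card_indefinite_le F x y z (K₁ - n₀) (-(K₂ - signedSq n₀)) R hR1 ?_ ?_ ?_ ?_ ?_ ?_ <;> grind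
    · refine card_indefinite_le F x z y (K₁ - n₀) (-(K₂ - signedSq n₀)) R hR1 ?_ ?_ ?_ ?_ ?_ ?_ <;> grind
    · refine card_indefinite_le F y z x (K₁ - n₀) (K₂ - signedSq n₀) R hR1 ?_ ?_ ?_ ?_ ?_ ?_ <;> grind
    · refine card_indefinite_le F y z x (K₁ - n₀) (-(K₂ - signedSq n₀)) R hR1 ?_ ?_ ?_ ?_ ?_ ?_ <;> grind
    · refine card_indefinite_le F x z y (K₁ - n₀) (K₂ - signedSq n₀) R hR1 ?_ ?_ ?_ ?_ ?_ ?_ <;> grind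
    · refine card_indefinite_le F x y z (K₁ - n₀) (K₂ - signedSq n₀) R hR1 ?_ ?_ ?_ ?_ ?_ ?_ <;> grind
    · refine card_definite_le F x y z (K₁ - n₀) (K₂ - signedSq n₀) R hR1 ?_ ?_ ?_ ?_ <;> grind
  have htotal : (s.card : ℝ) =
      ∑ σ : Bool × Bool × Bool, (({t ∈ s | sgn t = σ} : Finset _).card : ℝ) := by
    rw [Finset.card_eq_sum_card_fiberwise (f := sgn) (t := Finset.univ) (by simp)]
    push_cast; rfl
  rw [htotal]
  refine (Finset.sum_le_card_nsmul _ _ _ fun σ _ => hfiber σ).trans_eq ?_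
  rw [Finset.card_univ, show Fintype.card (Bool × Bool × Bool) = 8 from rfl, nsmul_eq_mul]
  push_cast
  ring
end

section
/- There exists a constant C > 0 such that for every real number α, Σ_{k ∈ ℤ} ⟨α − k²⟩^{−3/4} ≤ C. -/
/-- The weight `((1 + m²) / 6)^(-3/4)` dominating the summand after recentring. -/
noncomputable def recentredWeight (m : ℤ) : ℝ := ((1 + (m : ℝ) ^ 2) / 6) ^ (-(3 / 4) : ℝ)

lemma recentredWeight_nonneg (m : ℤ) : 0 ≤ recentredWeight m := by
  unfold recentredWeight
  positivity

lemma summable_recentredWeight : Summable recentredWeight := by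
  have hs : Summable fun m : ℤ => (6 : ℝ) ^ (3 / 4 : ℝ) * |(m : ℝ)| ^ (-(3 / 2) : ℝ) :=
    (Real.summable_abs_int_rpow (by norm_num)).mul_left _
  refine Summable.of_norm_bounded_eventually hs ?_
  filter_upwards [(Set.finite_singleton (0 : ℤ)).compl_mem_cofinite] with m hm
  have hm : (m : ℝ) ≠ 0 := by exact_mod_cast hm
  have hpos : 0 < |(m : ℝ)| := abs_pos.mpr hm
  rw [Real.norm_of_nonneg (recentredWeight_nonneg m)]
  calc recentredWeight m ≤ ((m : ℝ) ^ 2 / 6) ^ (-(3 / 4) : ℝ) :=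
        Real.rpow_le_rpow_of_nonpos (by positivity) (by linarith) (by norm_num)
    _ = (6 : ℝ) ^ (3 / 4 : ℝ) * |(m : ℝ)| ^ (-(3 / 2) : ℝ) := by
        rw [Real.div_rpow (by positivity) (by norm_num), Real.rpow_neg (x := 6) (by norm_num),
          div_inv_eq_mul, mul_comm, ← sq_abs, ← Real.rpow_natCast, ← Real.rpow_mul hpos.le]
        norm_num

/-- The distance from `α` to `k²` dominates the squared distance from `√α` to `|k|`. -/
lemma sq_abs_sub_sqrt_le (α x : ℝ) : (|x| - √α) ^ 2 ≤ |α - x ^ 2| := by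
  have hx := abs_nonneg x
  rw [← sq_abs x]
  rcases le_total α 0 with h | h
  · rw [Real.sqrt_eq_zero_of_nonpos h]
    exact le_trans (by linarith) (neg_le_abs _)
  · have hs := Real.sqrt_nonneg α
    have hα := Real.sq_sqrt h
    rcases le_total |x| √α with h' | h'
    · exact le_trans (by nlinarith) (le_abs_self _)
    · exact le_trans (by nlinarith) (neg_le_abs _)

lemma japaneseBracket_rpow_le_recentredWeight (α : ℝ) (k : ℤ) :
    √(1 + (α - (k : ℝ) ^ 2) ^ 2) ^ (-(3 / 4) : ℝ) ≤ recentredWeight (|k| - ⌊√α⌋) := by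
  refine Real.rpow_le_rpow_of_nonpos (by positivity) ?_ (by norm_num)
  have h₁ := sq_abs_sub_sqrt_le α k
  have h₂ : (1 + |α - (k : ℝ) ^ 2|) / 2 ≤ √(1 + (α - (k : ℝ) ^ 2) ^ 2) := by
    apply Real.le_sqrt_of_sq_le
    nlinarith [sq_abs (α - (k : ℝ) ^ 2), sq_nonneg (|α - (k : ℝ) ^ 2| - 1)]
  have h₃ := Int.fract_nonneg √α
  have h₄ := Int.fract_lt_one √α
  have h₅ := Int.floor_add_fract √α
  push_cast
  have h₆ : |(k : ℝ)| - ⌊√α⌋ = (|(k : ℝ)| - √α) + Int.fract √α := by linarith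
  rw [h₆]
  nlinarith [sq_nonneg ((|(k : ℝ)| - √α) - Int.fract √α)]

/-- Uniform bound on the lattice sum over shifted squares: there is `C > 0` with
`∑_{k ∈ ℤ} ⟨α − k²⟩^(−3/4) ≤ C` for every real `α`, where `⟨x⟩ = (1 + x²)^(1/2)`. -/
theorem sum_shifted_squares_bound :
    ∃ C : ℝ, 0 < C ∧ ∀ α : ℝ,
      (∑' k : ℤ, ENNReal.ofReal (Real.sqrt (1 + (α - (k : ℝ) ^ 2) ^ 2) ^ (-(3 / 4) : ℝ)))
        ≤ ENNReal.ofReal C := by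
  have hS : 0 ≤ ∑' m, recentredWeight m := tsum_nonneg recentredWeight_nonneg
  refine ⟨(∑' m, recentredWeight m) + (∑' m, recentredWeight m) + 1, by positivity, fun α => ?_⟩
  set F : ℤ → ENNReal := fun m => ENNReal.ofReal (recentredWeight m) with hF
  have hFsum : ∑' m, F m = ENNReal.ofReal (∑' m, recentredWeight m) :=
    (ENNReal.ofReal_tsum_of_nonneg recentredWeight_nonneg summable_recentredWeight).symm
  have hle (k : ℤ) : ENNReal.ofReal (√(1 + (α - (k : ℝ) ^ 2) ^ 2) ^ (-(3 / 4) : ℝ)) ≤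
      F (k - ⌊√α⌋) + F (-k - ⌊√α⌋) := by
    refine (ENNReal.ofReal_le_ofReal (japaneseBracket_rpow_le_recentredWeight α k)).trans ?_
    rcases abs_choice k with h | h <;> rw [h]
    · exact le_self_add
    · exact le_add_self
  calc _ ≤ ∑' k : ℤ, (F (k - ⌊√α⌋) + F (-k - ⌊√α⌋)) := ENNReal.tsum_le_tsum hle
    _ = ∑' m, F m + ∑' m, F m := by
        rw [ENNReal.tsum_add]
        congr 1
        · exact (Equiv.subRight ⌊√α⌋).tsum_eq F
        · exact ((Equiv.neg ℤ).trans (Equiv.subRight ⌊√α⌋)).tsum_eq F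
    _ ≤ _ := by
        rw [hFsum, ← ENNReal.ofReal_add hS hS]
        exact ENNReal.ofReal_le_ofReal (by linarith)
end
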